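/- arXiv:math/0601734 — 9 statements merged into one kernel-verified Lean document; each statement's English description precedes it below -/
import Mathlib

section
/- Let k be a field, F a k-vector space of finite dimension 2r+1, and ω an alternating bilinear form on F whose induced linear map L_ω : F → F* has rank 2t. If U ⊆ F is a linear subspace of dimension 2r+1−t on which ω vanishes identically, then the restriction of L_ω to U has rank t, and the image L_ω(U) equals the annihilator U^⊥ = {φ ∈ F* : φ(u) = 0 for all u ∈ U}. -/
open Module

/-- Let k be a field, F a k-vector space of finite dimension 2r+1, and ω an
alternating bilinear form on F whose induced linear map L_ω : F → F* has rank 2t. If U ⊆ F is a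
linear subspace of dimension 2r+1−t on which ω vanishes identically, then the restriction of
L_ω to U has rank t, and the image L_ω(U) equals the annihilator
U^⊥ = {φ ∈ F* : φ(u) = 0 for all u ∈ U}. -/
theorem rank_restriction_and_image_eq_annihilator
    (k : Type*) [Field k] (F : Type*) [AddCommGroup F] [Module k F]
    [FiniteDimensional k F] (r t : ℕ)
    (hdim : finrank k F = 2 * r + 1)
    (ω : F →ₗ[k] Module.Dual k F) (halt : ∀ x, ω x x = 0)
    (hrank : finrank k (LinearMap.range ω) = 2 * t)
    (U : Submodule k F) (hU : finrank k U = 2 * r + 1 - t)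
    (hvanish : ∀ u ∈ U, ∀ v ∈ U, ω u v = 0) :
    finrank k (U.map ω) = t ∧ U.map ω = U.dualAnnihilator := by
  have h_le : U.map ω ≤ U.dualAnnihilator := by
    rintro _ ⟨u, hu, rfl⟩
    exact (Submodule.mem_dualAnnihilator _).2 fun v hv => hvanish u hu v hv
  have h_ann := Subspace.finrank_add_finrank_dualAnnihilator_eq U
  have h_range := ω.finrank_range_add_finrank_ker
  have h_restrict := (ω.domRestrict U).finrank_range_add_finrank_ker
  rw [LinearMap.range_domRestrict] at h_restrict
  have h_ker : finrank k (LinearMap.ker (ω.domRestrict U)) ≤ finrank k (LinearMap.ker ω) := by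
    rw [← Submodule.finrank_map_subtype_eq U]
    refine Submodule.finrank_mono ?_
    rintro _ ⟨u, hu, rfl⟩
    exact hu
  have h_mono := Submodule.finrank_mono h_le
  have h_eq : finrank k (U.map ω) = t := by omega
  exact ⟨h_eq, Submodule.eq_of_le_of_finrank_eq h_le (by omega)⟩
end

section
/- Let k be a field and F a k-vector space of finite dimension 2r+1 with 2(2r+1) = 5t. Let ω₁, ω₂ be alternating bilinear forms on F, each of rank 2t, such that (1) ker ω₁ ∩ ker ω₂ = {0}, and (2) L_{ω₂}(ker ω₁) ∩ L_{ω₁}(ker ω₂) = {0} as subspaces of F*. If U ⊆ F is a linear subspace of dimension 2r+1−t on which both ω₁ and ω₂ vanish identically, then U = l(ω₁,ω₂) ∩ l(ω₂,ω₁). -/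
open Module

/-- For alternating forms ω₁, ω₂ on F, the subspace
`l(ω₁,ω₂) := {f ∈ F : ω₂(u,f) = 0 for all u ∈ ker ω₁}`. -/
def lSub {k F : Type*} [Field k] [AddCommGroup F] [Module k F]
    (ω₁ ω₂ : F →ₗ[k] F →ₗ[k] k) : Submodule k F where
  carrier := {f | ∀ u ∈ LinearMap.ker ω₁, ω₂ u f = 0}
  add_mem' := by
    intro a b ha hb u hu
    simp [map_add, ha u hu, hb u hu]
  zero_mem' := by
    intro u hu
    simp
  smul_mem' := by
    intro c a ha u hu
    simp [map_smul, ha u hu]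

section Isotropic

variable {k F : Type*} [Field k] [AddCommGroup F] [Module k F]

/-- `lSub ω₁ ω₂` is the subspace cut out by the functionals in `ω₂ (ker ω₁)`. -/
lemma lSub_eq_dualCoannihilator (ω₁ ω₂ : F →ₗ[k] F →ₗ[k] k) :
    lSub ω₁ ω₂ =
      Submodule.dualCoannihilator ((LinearMap.ker ω₁).map ω₂ : Submodule k (Dual k F)) := by
  ext f
  simp only [Submodule.mem_dualCoannihilator, Submodule.mem_map, forall_exists_index, and_imp,
    forall_apply_eq_imp_iff₂]
  rfl

/-- If `ker ω₁ ∩ ker ω₂ = 0` then `ω₂` is injective on `ker ω₁`. -/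
lemma finrank_map_ker_of_disjoint (ω₁ ω₂ : F →ₗ[k] F →ₗ[k] k)
    (hdisj : Disjoint (LinearMap.ker ω₁) (LinearMap.ker ω₂)) :
    finrank k ((LinearMap.ker ω₁).map ω₂) = finrank k (LinearMap.ker ω₁) := by
  rw [← LinearMap.range_domRestrict]
  exact LinearMap.finrank_range_of_inj <| LinearMap.injective_domRestrict_iff.2 hdisj

variable [FiniteDimensional k F]

/-- An isotropic subspace containing the kernel of the form has dimension at most
`(dim F + dim ker ω) / 2`. -/
lemma two_mul_finrank_le_of_isotropic_of_ker_le (ω : F →ₗ[k] F →ₗ[k] k) (W : Submodule k F)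
    (hW : ∀ u ∈ W, ∀ v ∈ W, ω u v = 0) (hker : LinearMap.ker ω ≤ W) :
    2 * finrank k W ≤ finrank k F + finrank k (LinearMap.ker ω) := by
  have hle : (W.map ω : Submodule k (Dual k F)) ≤ W.dualAnnihilator := by
    rintro _ ⟨u, hu, rfl⟩
    exact (Submodule.mem_dualAnnihilator _).2 fun v hv => hW u hu v hv
  have hmap : finrank k (W.map ω) + finrank k (LinearMap.ker ω) = finrank k W := by
    have h := (ω.domRestrict W).finrank_range_add_finrank_ker
    rw [LinearMap.range_domRestrict, LinearMap.ker_domRestrict,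
      (Submodule.comapSubtypeEquivOfLe hker).finrank_eq] at h
    exact h
  have hann := Subspace.finrank_add_finrank_dualAnnihilator_eq W
  have hmono : finrank k (W.map ω) ≤ finrank k W.dualAnnihilator := Submodule.finrank_mono hle
  omega

/-- An isotropic subspace of the maximal possible dimension contains the kernel of the form. -/
lemma ker_le_of_isotropic_of_finrank (ω : F →ₗ[k] F →ₗ[k] k) (halt : ω.IsAlt)
    (U : Submodule k F) (hU : ∀ u ∈ U, ∀ v ∈ U, ω u v = 0)
    (hdim : finrank k F + finrank k (LinearMap.ker ω) ≤ 2 * finrank k U) :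
    LinearMap.ker ω ≤ U := by
  have hW : ∀ u ∈ U ⊔ LinearMap.ker ω, ∀ v ∈ U ⊔ LinearMap.ker ω, ω u v = 0 := by
    intro u hu v hv
    obtain ⟨a, ha, b, hb, rfl⟩ := Submodule.mem_sup.1 hu
    obtain ⟨c, hc, d, hd, rfl⟩ := Submodule.mem_sup.1 hv
    have had : ω a d = 0 := halt.isRefl d a (by simp [LinearMap.mem_ker.1 hd])
    simp [LinearMap.mem_ker.1 hb, hU a ha c hc, had]
  have hle := two_mul_finrank_le_of_isotropic_of_ker_le ω _ hW le_sup_right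
  have heq : U = U ⊔ LinearMap.ker ω :=
    Submodule.eq_of_le_of_finrank_le le_sup_left (by omega)
  exact heq ▸ le_sup_right

end Isotropic

/-- Let k be a field and F a k-vector space of finite dimension 2r+1 with
2(2r+1) = 5t. Let ω₁, ω₂ be alternating bilinear forms on F, each of rank 2t, such that
(1) ker ω₁ ∩ ker ω₂ = {0}, and (2) L_{ω₂}(ker ω₁) ∩ L_{ω₁}(ker ω₂) = {0} in F*. If U ⊆ F is a
linear subspace of dimension 2r+1−t on which both ω₁ and ω₂ vanish identically, then
U = l(ω₁,ω₂) ∩ l(ω₂,ω₁). -/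
theorem isotropic_subspace_eq_l_inter_l
    (k : Type*) [Field k] (F : Type*) [AddCommGroup F] [Module k F]
    [FiniteDimensional k F] (r t : ℕ)
    (hdim : finrank k F = 2 * r + 1)
    (hrt : 2 * (2 * r + 1) = 5 * t)
    (ω₁ ω₂ : F →ₗ[k] F →ₗ[k] k)
    (halt₁ : ∀ x, ω₁ x x = 0) (halt₂ : ∀ x, ω₂ x x = 0)
    (hrank₁ : finrank k (LinearMap.range ω₁) = 2 * t)
    (hrank₂ : finrank k (LinearMap.range ω₂) = 2 * t)
    (hker : LinearMap.ker ω₁ ⊓ LinearMap.ker ω₂ = ⊥)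
    (himg : (LinearMap.ker ω₁).map ω₂ ⊓ (LinearMap.ker ω₂).map ω₁ = ⊥)
    (U : Submodule k F) (hU : finrank k U = 2 * r + 1 - t)
    (hvanish₁ : ∀ u ∈ U, ∀ v ∈ U, ω₁ u v = 0)
    (hvanish₂ : ∀ u ∈ U, ∀ v ∈ U, ω₂ u v = 0) :
    U = lSub ω₁ ω₂ ⊓ lSub ω₂ ω₁ := by
  have hnull₁ := ω₁.finrank_range_add_finrank_ker
  have hnull₂ := ω₂.finrank_range_add_finrank_ker
  have hK₁ : LinearMap.ker ω₁ ≤ U :=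
    ker_le_of_isotropic_of_finrank ω₁ halt₁ U hvanish₁ (by omega)
  have hK₂ : LinearMap.ker ω₂ ≤ U :=
    ker_le_of_isotropic_of_finrank ω₂ halt₂ U hvanish₂ (by omega)
  have hUle : U ≤ lSub ω₁ ω₂ ⊓ lSub ω₂ ω₁ := fun f hf =>
    ⟨fun u hu => hvanish₂ u (hK₁ hu) f hf, fun u hu => hvanish₁ u (hK₂ hu) f hf⟩
  refine Submodule.eq_of_le_of_finrank_le hUle ?_
  have hdisj := disjoint_iff.2 hker
  have hmap₁ := finrank_map_ker_of_disjoint ω₁ ω₂ hdisj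
  have hmap₂ := finrank_map_ker_of_disjoint ω₂ ω₁ hdisj.symm
  have hsum := Submodule.finrank_sup_add_finrank_inf_eq
    ((LinearMap.ker ω₁).map ω₂) ((LinearMap.ker ω₂).map ω₁)
  rw [himg, finrank_bot] at hsum
  have hco := Subspace.finrank_add_finrank_dualCoannihilator_eq
    ((LinearMap.ker ω₁).map ω₂ ⊔ (LinearMap.ker ω₂).map ω₁ : Submodule k (Dual k F))
  rw [Submodule.dualCoannihilator_sup_eq, ← lSub_eq_dualCoannihilator,
    ← lSub_eq_dualCoannihilator] at hco
  have hsum' : finrank k ((LinearMap.ker ω₁).map ω₂ ⊔ (LinearMap.ker ω₂).map ω₁ :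
      Submodule k (Dual k F)) = _ := hsum
  omega
end

section
/- Let k be an algebraically closed field and F a 5-dimensional k-vector space. For any two alternating bilinear forms ω₁, ω₂ on F there exists a 3-dimensional linear subspace U ⊆ F on which both ω₁ and ω₂ vanish identically. -/
open Module

section AlternatingForms

variable {k V : Type*} [Field k] [AddCommGroup V] [Module k V]

theorem LinearMap.IsAlt.linearIndependent_pair {B : V →ₗ[k] V →ₗ[k] k} (hB : B.IsAlt) {a b : V}
    (hab : B a b ≠ 0) : LinearIndependent k ![a, b] := by
  rw [LinearIndependent.pair_iff]
  intro s t h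
  have hb : s * B a b = 0 := by simpa [hB b] using congrArg (fun v => B v b) h
  have ha : t * B a b = 0 := by simpa [hB a] using congrArg (B a) h
  simp_all

/-- An alternating form on an odd-dimensional space has a nontrivial kernel. -/
theorem LinearMap.IsAlt.exists_ne_zero_of_odd_finrank [FiniteDimensional k V]
    {B : V →ₗ[k] V →ₗ[k] k} (hB : B.IsAlt) (hodd : Odd (finrank k V)) :
    ∃ x ≠ 0, B x = 0 := by
  induction hn : finrank k V using Nat.strong_induction_on generalizing V with
  | _ n ih =>
    have : Nontrivial V := Module.nontrivial_of_finrank_pos (R := k) hodd.pos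
    by_cases h0 : B = 0
    · obtain ⟨x, hx⟩ := exists_ne (0 : V)
      exact ⟨x, hx, by simp [h0]⟩
    obtain ⟨a, b, hab⟩ : ∃ a b, B a b ≠ 0 := by
      by_contra! h
      exact h0 (LinearMap.ext₂ h)
    let P : Submodule k V := Submodule.span k {a, b}
    have haP : a ∈ P := Submodule.subset_span (by simp)
    have hbP : b ∈ P := Submodule.subset_span (by simp)
    have hP : finrank k P = 2 := by
      have hrange : ({a, b} : Set V) = Set.range ![a, b] := by
        simp [Matrix.range_cons, Set.pair_comm]
      change finrank k (Submodule.span k {a, b}) = 2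
      rw [hrange, finrank_span_eq_card (hB.linearIndependent_pair hab), Fintype.card_fin]
    let Q := LinearMap.BilinForm.orthogonal B P
    have hdisj : Disjoint P Q := by
      rw [Submodule.disjoint_def]
      intro x hx hxQ
      obtain ⟨s, t, rfl⟩ := Submodule.mem_span_pair.1 hx
      have h₁ := hxQ a haP
      have h₂ := hxQ b hbP
      have hba : B b a ≠ 0 := fun h => hab (by rw [← hB.neg, h, neg_zero])
      simp [hB a, hB b, hab, hba] at h₁ h₂
      simp [h₁, h₂]
    have hcompl : IsCompl P Q :=
      (LinearMap.BilinForm.isCompl_orthogonal_iff_disjoint hB.isRefl).2 hdisj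
    have hdim := Submodule.finrank_add_eq_of_isCompl hcompl
    obtain ⟨x, hx, hBx⟩ := ih (finrank k Q) (by omega) (V := Q) (B := B.compl₁₂ Q.subtype Q.subtype)
      (fun x => hB x) (by rw [Nat.odd_iff] at hodd ⊢; omega) rfl
    refine ⟨x, by simpa using hx, LinearMap.ext fun y => ?_⟩
    obtain ⟨p, hp, q, hq, rfl⟩ := Submodule.mem_sup.1
      (hcompl.sup_eq_top ▸ Submodule.mem_top : y ∈ P ⊔ Q)
    have h₁ : B x p = 0 := hB.isRefl _ _ (x.2 p hp)
    have h₂ : B x q = 0 := LinearMap.congr_fun hBx ⟨q, hq⟩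
    simp [h₁, h₂]

/-- Two alternating forms on a three-dimensional space have a common isotropic plane. -/
theorem exists_common_isotropic_pair [FiniteDimensional k V] (hV : finrank k V = 3)
    {B₁ B₂ : V →ₗ[k] V →ₗ[k] k} (h₁ : B₁.IsAlt) (h₂ : B₂.IsAlt) :
    ∃ x y, LinearIndependent k ![x, y] ∧ B₁ x y = 0 ∧ B₂ x y = 0 := by
  have hodd : Odd (finrank k V) := hV ▸ by decide
  obtain ⟨x, hx, hBx⟩ := h₁.exists_ne_zero_of_odd_finrank hodd
  obtain ⟨y, hy, hBy⟩ := h₂.exists_ne_zero_of_odd_finrank hodd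
  by_cases hxy : LinearIndependent k ![x, y]
  · exact ⟨x, y, hxy, by simp [hBx], by rw [← h₂.neg, hBy]; simp⟩
  · obtain ⟨z, hz⟩ := exists_linearIndependent_pair_of_one_lt_finrank (R := k) (M := V) (by omega) hx
    have : ¬ ∀ c : k, c • x ≠ y := fun h => hxy ((LinearIndependent.pair_iff' hx).2 h)
    push Not at this
    obtain ⟨c, rfl⟩ := this
    have hc : c ≠ 0 := fun h => hy (by simp [h])
    have hB₂x : B₂ x = 0 := by simpa [hc] using hBy
    exact ⟨x, z, hz, by simp [hBx], by simp [hB₂x]⟩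

/-- An alternating form vanishes on the span of pairwise orthogonal vectors. -/
theorem LinearMap.IsAlt.apply_eq_zero_of_mem_span_triple {B : V →ₗ[k] V →ₗ[k] k} (hB : B.IsAlt)
    {x y z : V} (hxy : B x y = 0) (hxz : B x z = 0) (hyz : B y z = 0) {u v : V}
    (hu : u ∈ Submodule.span k {x, y, z}) (hv : v ∈ Submodule.span k {x, y, z}) :
    B u v = 0 := by
  obtain ⟨a, b, c, rfl⟩ := Submodule.mem_span_triple.1 hu
  obtain ⟨a', b', c', rfl⟩ := Submodule.mem_span_triple.1 hv
  have hyx := hB.isRefl _ _ hxy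
  have hzx := hB.isRefl _ _ hxz
  have hzy := hB.isRefl _ _ hyz
  simp [hB x, hB y, hB z, *]

end AlternatingForms

/-- Let k be an algebraically closed field and F a 5-dimensional k-vector space.
For any two alternating bilinear forms ω₁, ω₂ on F there exists a 3-dimensional linear subspace
U ⊆ F on which both ω₁ and ω₂ vanish identically. -/
theorem exists_common_isotropic_threespace
    (k : Type*) [Field k] [IsAlgClosed k]
    (F : Type*) [AddCommGroup F] [Module k F] [FiniteDimensional k F]
    (hdim : finrank k F = 5)
    (ω₁ ω₂ : F →ₗ[k] F →ₗ[k] k)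
    (halt₁ : ∀ x, ω₁ x x = 0) (halt₂ : ∀ x, ω₂ x x = 0) :
    ∃ U : Submodule k F, finrank k U = 3 ∧
      (∀ u ∈ U, ∀ v ∈ U, ω₁ u v = 0) ∧ (∀ u ∈ U, ∀ v ∈ U, ω₂ u v = 0) := by
  have hω₁ : ω₁.IsAlt := halt₁
  have hω₂ : ω₂.IsAlt := halt₂
  obtain ⟨e, he, hωe⟩ := hω₁.exists_ne_zero_of_odd_finrank (hdim ▸ by decide)
  obtain ⟨H, hH⟩ := Submodule.exists_isCompl (Submodule.span k {e})
  let W := LinearMap.ker (ω₂ e)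
  have hHdim : finrank k H = 4 := by
    have := Submodule.finrank_add_eq_of_isCompl hH
    rw [finrank_span_singleton he] at this
    omega
  have hWdim : 4 ≤ finrank k W := by
    have h₁ := LinearMap.finrank_range_add_finrank_ker (ω₂ e)
    have h₂ := Submodule.finrank_le (LinearMap.range (ω₂ e))
    rw [finrank_self] at h₂
    change _ + finrank k W = _ at h₁
    omega
  have hHW : 3 ≤ finrank k ↥(H ⊓ W) := by
    have h₁ := Submodule.finrank_sup_add_finrank_inf_eq H W
    have h₂ := Submodule.finrank_le (H ⊔ W)
    omega
  obtain ⟨w, hw⟩ := exists_linearIndependent_of_le_finrank hHW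
  let f : (Fin 3 → k) →ₗ[k] F := (H ⊓ W).subtype ∘ₗ Fintype.linearCombination k w
  have hf : LinearMap.ker f = ⊥ := by
    rw [LinearMap.ker_comp_of_ker_eq_bot _ (Submodule.ker_subtype _)]
    exact LinearMap.ker_eq_bot.2 hw.fintypeLinearCombination_injective
  have hfmem (c : Fin 3 → k) : f c ∈ H ⊓ W := (Fintype.linearCombination k w c).2
  obtain ⟨x, y, hxy, h₁, h₂⟩ := exists_common_isotropic_pair (V := Fin 3 → k) (by simp)
    (B₁ := ω₁.compl₁₂ f f) (B₂ := ω₂.compl₁₂ f f) (fun _ => halt₁ _) (fun _ => halt₂ _)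
  have hli : LinearIndependent k ![e, f x, f y] := by
    have hfxy : LinearIndependent k ![f x, f y] := by
      have hcomp : f ∘ ![x, y] = ![f x, f y] := by
        ext i; fin_cases i <;> rfl
      exact hcomp ▸ hxy.map' f hf
    refine linearIndependent_finCons.2 ⟨hfxy, fun hmem => he ?_⟩
    refine Submodule.disjoint_def.1 hH.disjoint e (Submodule.mem_span_singleton_self e) ?_
    refine Submodule.span_le.2 ?_ hmem
    rintro _ ⟨i, rfl⟩
    fin_cases i
    exacts [(hfmem x).1, (hfmem y).1]
  refine ⟨Submodule.span k {e, f x, f y}, ?_, fun u hu v hv => ?_, fun u hu v hv => ?_⟩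
  · have hrange : ({e, f x, f y} : Set F) = Set.range ![e, f x, f y] := by
      ext v
      simp [Matrix.range_cons]
      tauto
    rw [hrange, finrank_span_eq_card hli, Fintype.card_fin]
  · exact hω₁.apply_eq_zero_of_mem_span_triple (by simp [hωe]) (by simp [hωe]) h₁ hu hv
  · exact hω₂.apply_eq_zero_of_mem_span_triple (hfmem x).2 (hfmem y).2 h₂ hu hv
end

section
/- Let k be an algebraically closed field and F a 5-dimensional k-vector space. Let ω₁, ω₂ be alternating bilinear forms on F such that for every (α₁,α₂) ∈ k² with (α₁,α₂) ≠ (0,0), the form α₁ω₁ + α₂ω₂ has rank 4. Then there exists a basis (f₁,…,f₅) of F, with dual basis (f₁*,…,f₅*) of F*, such that ω₁ = f₂*∧f₄* + f₃*∧f₅* and ω₂ = f₁*∧f₅* + f₃*∧f₄*. -/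
open Module

/-- For linear functionals φ, ψ on F, the alternating bilinear form
`φ∧ψ : (x,y) ↦ φ(x)ψ(y) − ψ(x)φ(y)`. -/
def wedge {k F : Type*} [Field k] [AddCommGroup F] [Module k F]
    (φ ψ : F →ₗ[k] k) : F →ₗ[k] F →ₗ[k] k :=
  LinearMap.mk₂ k (fun x y => φ x * ψ y - ψ x * φ y)
    (fun x x' y => by simp [map_add]; ring)
    (fun c x y => by simp [map_smul, smul_eq_mul]; ring)
    (fun x y y' => by simp [map_add]; ring)
    (fun c x y => by simp [map_smul, smul_eq_mul]; ring)

section RankFourPencil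

variable {k F : Type*} [Field k] [AddCommGroup F] [Module k F]

theorem alternating_swap {ω : F →ₗ[k] F →ₗ[k] k} (halt : ∀ x, ω x x = 0) (x y : F) :
    ω x y = -ω y x :=
  (LinearMap.IsAlt.neg (B := ω) halt y x).symm

theorem exists_dual_pair {φ ψ : F →ₗ[k] k} (h : ∀ a b : k, a • φ + b • ψ = 0 → a = 0 ∧ b = 0) :
    ∃ x y : F, φ x = 1 ∧ ψ x = 0 ∧ φ y = 0 ∧ ψ y = 1 := by
  have hsurj : Function.Surjective (φ.prod ψ) := by
    rw [← LinearMap.range_eq_top]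
    by_contra hne
    obtain ⟨f, hf, hfr⟩ := Submodule.exists_le_ker_of_lt_top _ (lt_top_iff_ne_top.2 hne)
    have hcomb : f (1, 0) • φ + f (0, 1) • ψ = 0 := by
      ext z
      have hz : f (φ z, ψ z) = 0 := hfr ⟨z, rfl⟩
      have hsplit : ((φ z, ψ z) : k × k) = φ z • (1, 0) + ψ z • (0, 1) := by simp
      rw [hsplit, map_add, map_smul, map_smul] at hz
      simpa [mul_comm] using hz
    obtain ⟨ha, hb⟩ := h _ _ hcomb
    apply hf
    ext <;> simp [ha, hb]
  obtain ⟨x, hx⟩ := hsurj (1, 0)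
  obtain ⟨y, hy⟩ := hsurj (0, 1)
  simp only [LinearMap.prod_apply, Function.prod, Prod.mk.injEq] at hx hy
  exact ⟨x, y, hx.1, hx.2, hy.1, hy.2⟩

theorem alternating_ext_basis {n : ℕ} (f : Basis (Fin n) k F) {ω ω' : F →ₗ[k] F →ₗ[k] k}
    (halt : ∀ x, ω x x = 0) (halt' : ∀ x, ω' x x = 0)
    (h : ∀ i j, i < j → ω (f i) (f j) = ω' (f i) (f j)) : ω = ω' := by
  refine f.ext fun i => f.ext fun j => ?_
  rcases lt_trichotomy i j with hij | rfl | hij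
  · exact h i j hij
  · rw [halt, halt']
  · rw [alternating_swap halt, alternating_swap halt', h j i hij]

theorem wedge_self_apply (φ ψ : F →ₗ[k] k) (x : F) : wedge φ ψ x x = 0 := by
  simp [wedge, mul_comm]

theorem wedge_coord_apply {n : ℕ} (f : Basis (Fin n) k F) (a b i j : Fin n) :
    wedge (f.coord a) (f.coord b) (f i) (f j) =
      (if i = a then 1 else 0) * (if j = b then 1 else 0) -
        (if i = b then 1 else 0) * (if j = a then 1 else 0) := by
  simp [wedge, Finsupp.single_apply]

variable [FiniteDimensional k F]

theorem finrank_ker_eq_one {ω : F →ₗ[k] F →ₗ[k] k}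
    (hr : finrank k (LinearMap.range ω) + 1 = finrank k F) :
    finrank k (LinearMap.ker ω) = 1 := by
  have := LinearMap.finrank_range_add_finrank_ker ω
  omega

theorem exists_smul_eq_of_corank_one {ω : F →ₗ[k] F →ₗ[k] k}
    (hr : finrank k (LinearMap.range ω) + 1 = finrank k F)
    {v u : F} (hv : v ≠ 0) (hωv : ω v = 0) (hωu : ω u = 0) : ∃ c : k, c • v = u := by
  obtain ⟨c, hc⟩ := (finrank_eq_one_iff_of_nonzero' (⟨v, hωv⟩ : LinearMap.ker ω)
    (fun h => hv (congrArg Subtype.val h))).1 (finrank_ker_eq_one hr) ⟨u, hωu⟩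
  exact ⟨c, congrArg Subtype.val hc⟩

theorem exists_ne_zero_of_corank_one {ω : F →ₗ[k] F →ₗ[k] k}
    (hr : finrank k (LinearMap.range ω) + 1 = finrank k F) : ∃ v, v ≠ 0 ∧ ω v = 0 := by
  obtain ⟨v, hv, -⟩ := finrank_eq_one_iff'.1 (finrank_ker_eq_one hr)
  exact ⟨v, fun h => hv (Subtype.ext h), v.2⟩

/-- The image of a corank one alternating form is the annihilator of its radical. -/
theorem exists_eq_of_corank_one {ω : F →ₗ[k] F →ₗ[k] k} (halt : ∀ x, ω x x = 0)
    (hr : finrank k (LinearMap.range ω) + 1 = finrank k F)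
    {v : F} (hv : v ≠ 0) (hωv : ω v = 0) {φ : F →ₗ[k] k} (hφ : φ v = 0) : ∃ y, ω y = φ := by
  have hle : LinearMap.range ω ≤ (k ∙ v).dualAnnihilator := by
    rintro _ ⟨y, rfl⟩
    rw [Submodule.mem_dualAnnihilator]
    intro w hw
    obtain ⟨c, rfl⟩ := Submodule.mem_span_singleton.1 hw
    rw [map_smul, alternating_swap halt y v, hωv]
    simp
  have hfin := Subspace.finrank_add_finrank_dualAnnihilator_eq (k ∙ v)
  rw [finrank_span_singleton hv] at hfin
  have heq := Submodule.eq_of_le_of_finrank_eq hle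
    (Nat.add_right_cancel (hr.trans (hfin.symm.trans (add_comm _ _))))
  have hmem : φ ∈ (k ∙ v).dualAnnihilator := by
    rw [Submodule.mem_dualAnnihilator]
    intro w hw
    obtain ⟨c, rfl⟩ := Submodule.mem_span_singleton.1 hw
    simp [hφ]
  rw [← heq] at hmem
  exact hmem

/-- Totally isotropic subspaces of a form of rank four in dimension five have dimension at most
three. -/
theorem not_linearIndependent_of_isotropic {ω : F →ₗ[k] F →ₗ[k] k} (halt : ∀ x, ω x x = 0)
    (hdim : finrank k F = 5) (hr : finrank k (LinearMap.range ω) = 4)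
    {v : Fin 4 → F} (hiso : ∀ i j, ω (v i) (v j) = 0) : ¬ LinearIndependent k v := by
  intro hv
  have hW := finrank_span_eq_card hv
  set W := Submodule.span k (Set.range v) with hWdef
  have hle : W ≤ LinearMap.BilinForm.orthogonal ω W := by
    rw [hWdef, Submodule.span_le]
    rintro _ ⟨j, rfl⟩ x hx
    induction hx using Submodule.span_induction with
    | mem x hx => obtain ⟨i, rfl⟩ := hx; exact hiso i j
    | zero => simp
    | add x y _ _ hx hy =>
      change ω x (v j) = 0 at hx
      change ω y (v j) = 0 at hy
      simp [hx, hy]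
    | smul c x _ hx =>
      change ω x (v j) = 0 at hx
      simp [hx]
  have hfin := LinearMap.BilinForm.finrank_add_finrank_orthogonal
    (LinearMap.IsAlt.isRefl (B := ω) halt) W
  have h1 := Submodule.finrank_mono hle
  have hker : W ⊓ LinearMap.BilinForm.orthogonal ω ⊤ ≤ LinearMap.ker ω := by
    rintro x ⟨-, hx⟩
    rw [LinearMap.mem_ker]
    ext y
    rw [alternating_swap halt, hx y trivial]
    simp
  have h2 := Submodule.finrank_mono hker
  have h3 := finrank_ker_eq_one (ω := ω) (by omega)
  simp only [Fintype.card_fin] at hW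
  omega

theorem exists_linearIndependent_cons {n : ℕ} {v : Fin n → F} (hv : LinearIndependent k v)
    {K : Submodule k F} (hK : n < finrank k K) :
    ∃ x ∈ K, LinearIndependent k (Fin.cons x v : Fin (n + 1) → F) := by
  by_contra! h
  have hle : K ≤ Submodule.span k (Set.range v) := by
    intro x hx
    by_contra hx'
    exact h x hx (linearIndependent_finCons.2 ⟨hv, hx'⟩)
  have h1 := Submodule.finrank_mono hle
  rw [finrank_span_eq_card hv, Fintype.card_fin] at h1
  omega

variable {ω₁ ω₂ : F →ₗ[k] F →ₗ[k] k}

theorem eq_zero_of_common_radical [IsAlgClosed k] (hdim : finrank k F = 5)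
    (halt₁ : ∀ x, ω₁ x x = 0) (halt₂ : ∀ x, ω₂ x x = 0)
    (hrank : ∀ α₁ α₂ : k, (α₁, α₂) ≠ (0, 0) →
      finrank k (LinearMap.range (α₁ • ω₁ + α₂ • ω₂)) = 4)
    {v : F} (h₁ : ω₁ v = 0) (h₂ : ω₂ v = 0) : v = 0 := by
  by_contra hv
  have hr₁ : finrank k (LinearMap.range ω₁) = 4 := by
    have h := hrank 1 0 (by simp)
    rwa [one_smul, zero_smul, add_zero] at h
  obtain ⟨ψ, hψ⟩ := Module.Projective.exists_dual_ne_zero k hv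
  have hproj : ∀ y, y - (ψ y / ψ v) • v ∈ LinearMap.ker ψ := by
    intro y
    simp [hψ]
  have hlift : ∀ x : LinearMap.ker ψ, ∃ y : LinearMap.ker ψ, ω₁ y = ω₂ x := by
    intro x
    obtain ⟨y, hy⟩ := exists_eq_of_corank_one halt₁ (by omega) hv h₁ (φ := ω₂ x)
      (by rw [alternating_swap halt₂, h₂]; simp)
    exact ⟨⟨_, hproj y⟩, by simp [h₁, hy]⟩
  have hinj : Function.Injective (ω₁ ∘ₗ (LinearMap.ker ψ).subtype) := by
    rw [← LinearMap.ker_eq_bot, LinearMap.ker_eq_bot']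
    intro x hx
    obtain ⟨c, hc⟩ := exists_smul_eq_of_corank_one (ω := ω₁) (by omega) hv h₁ hx
    have hx' : ψ x = 0 := x.2
    have hc' : c • v = (x : F) := hc
    rw [← hc', map_smul, smul_eq_mul, mul_eq_zero, or_iff_left hψ] at hx'
    ext
    rw [← hc', hx']
    simp
  choose T hT using hlift
  let T' : Module.End k (LinearMap.ker ψ) :=
    { toFun := T
      map_add' := fun x y => hinj (by simp [hT])
      map_smul' := fun c x => hinj (by simp [hT]) }
  have hnt : Nontrivial (LinearMap.ker ψ) := by
    apply Module.nontrivial_of_finrank_pos (R := k)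
    have h1 := LinearMap.finrank_range_add_finrank_ker ψ
    have h2 := Submodule.finrank_le (LinearMap.range ψ)
    rw [finrank_self] at h2
    omega
  obtain ⟨t, ht⟩ := Module.End.exists_eigenvalue T'
  obtain ⟨x, hx, hx0⟩ := ht.exists_hasEigenvector
  have hTx : T x = t • x := Module.End.mem_eigenspace_iff.1 hx
  have hωx : ω₂ x = t • ω₁ x := by rw [← hT x, hTx]; simp
  obtain ⟨c, hc⟩ := exists_smul_eq_of_corank_one (ω := (-t) • ω₁ + (1 : k) • ω₂)
    (by rw [hrank _ _ (by simp), hdim]) hv (by simp [h₁, h₂]) (u := x) (by simp [hωx])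
  apply hx0
  apply hinj
  simp [← hc, h₁]

theorem eq_zero_of_linear_radical [IsAlgClosed k] (hdim : finrank k F = 5)
    (halt₁ : ∀ x, ω₁ x x = 0) (halt₂ : ∀ x, ω₂ x x = 0)
    (hrank : ∀ α₁ α₂ : k, (α₁, α₂) ≠ (0, 0) →
      finrank k (LinearMap.range (α₁ • ω₁ + α₂ • ω₂)) = 4)
    {u₀ u₁ : F} (h₀ : ω₁ u₀ = 0) (h₀₁ : ω₁ u₁ = -ω₂ u₀) (h₁ : ω₂ u₁ = 0) : u₀ = 0 := by
  by_contra hu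
  have hφ : ω₂ u₀ ≠ 0 := fun h =>
    hu (eq_zero_of_common_radical hdim halt₁ halt₂ hrank h₀ h)
  have hli : LinearIndependent k ![u₀, u₁] := by
    rw [LinearIndependent.pair_iff]
    intro a b hab
    have hb := congrArg ω₁ hab
    simp only [map_add, map_smul, h₀, h₀₁, smul_zero, zero_add, smul_neg, map_zero, neg_eq_zero,
      smul_eq_zero, or_iff_left hφ] at hb
    subst hb
    simpa [hu] using hab
  have hK : 4 ≤ finrank k (LinearMap.ker (ω₂ u₀)) := by
    have h1 := LinearMap.finrank_range_add_finrank_ker (ω₂ u₀)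
    have h2 := Submodule.finrank_le (LinearMap.range (ω₂ u₀))
    rw [finrank_self] at h2
    omega
  obtain ⟨x, hx, hlix⟩ := exists_linearIndependent_cons hli (K := LinearMap.ker (ω₂ u₀)) (by omega)
  obtain ⟨y, hy, hliy⟩ := exists_linearIndependent_cons hlix (K := LinearMap.ker (ω₂ u₀)) (by omega)
  obtain ⟨α, β, hαβ, hxy⟩ : ∃ α β : k, (α, β) ≠ (0, 0) ∧ α * ω₁ x y + β * ω₂ x y = 0 := by
    by_cases h : ω₁ x y = 0
    · exact ⟨1, 0, by simp, by simp [h]⟩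
    · exact ⟨ω₂ x y, -ω₁ x y, by simp [h], by ring⟩
  set ω := α • ω₁ + β • ω₂ with hω
  have halt : ∀ z, ω z z = 0 := fun z => by simp [hω, halt₁, halt₂]
  have hu₀ : ∀ z ∈ LinearMap.ker (ω₂ u₀), ω u₀ z = 0 := fun z hz => by
    simp [hω, h₀, LinearMap.mem_ker.1 hz]
  have hu₁ : ∀ z ∈ LinearMap.ker (ω₂ u₀), ω u₁ z = 0 := fun z hz => by
    simp [hω, h₀₁, h₁, LinearMap.mem_ker.1 hz]
  have hm₁ : u₁ ∈ LinearMap.ker (ω₂ u₀) := by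
    rw [LinearMap.mem_ker, alternating_swap halt₂, h₁]
    simp
  have hωxy : ω x y = 0 := by simpa [hω] using hxy
  refine not_linearIndependent_of_isotropic (v := ![y, x, u₀, u₁]) halt hdim (hrank α β hαβ) ?_ hliy
  have hs := alternating_swap halt
  intro i j
  fin_cases i <;> fin_cases j <;>
    simp [halt, hu₀ _ hx, hu₀ _ hy, hu₀ _ hm₁, hu₁ _ hx, hu₁ _ hy, hωxy, hs y x,
      hs x u₀, hs x u₁, hs y u₀, hs y u₁, hs u₁ u₀]

/-- The vectors `f₁, f₂, f₃` are, up to sign, the coefficients of the quadratic family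
`α² f₁ - αβ f₃ + β² f₂` of radicals of the forms `α ω₁ + β ω₂`. -/
theorem exists_quadratic_radical [IsAlgClosed k] (hdim : finrank k F = 5)
    (halt₁ : ∀ x, ω₁ x x = 0) (halt₂ : ∀ x, ω₂ x x = 0)
    (hrank : ∀ α₁ α₂ : k, (α₁, α₂) ≠ (0, 0) →
      finrank k (LinearMap.range (α₁ • ω₁ + α₂ • ω₂)) = 4) :
    ∃ f₁ f₂ f₃ : F, f₁ ≠ 0 ∧ ω₁ f₁ = 0 ∧ ω₁ f₃ = ω₂ f₁ ∧ ω₁ f₂ = ω₂ f₃ ∧ ω₂ f₂ = 0 := by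
  have hr₁ : finrank k (LinearMap.range ω₁) = 4 := by
    have h := hrank 1 0 (by simp)
    rwa [one_smul, zero_smul, add_zero] at h
  have hs₁ := alternating_swap halt₁
  have hs₂ := alternating_swap halt₂
  obtain ⟨v₀, hv₀, h₀⟩ := exists_ne_zero_of_corank_one (ω := ω₁) (by omega)
  have hsolve : ∀ w, ω₂ w v₀ = 0 → ∃ y, ω₁ y = ω₂ w := fun w hw =>
    exists_eq_of_corank_one halt₁ (by omega) hv₀ h₀ hw
  obtain ⟨v₁, h₁⟩ := hsolve v₀ (halt₂ v₀)
  obtain ⟨v₂, h₂⟩ := hsolve v₁ (by rw [hs₂, ← h₁, halt₁, neg_zero])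
  have h₁₁ : ω₂ v₀ v₂ = 0 := by rw [← h₁, hs₁, h₂, halt₂, neg_zero]
  obtain ⟨v₃, h₃⟩ := hsolve v₂ (by rw [hs₂, h₁₁, neg_zero])
  have h₁₂ : ω₁ v₁ v₂ = 0 := by rw [h₁, h₁₁]
  have h₂₃ : ω₁ v₂ v₃ = 0 := by rw [hs₁, h₃, halt₂, neg_zero]
  have h₁₃ : ω₁ v₁ v₃ = 0 := by rw [hs₁, h₃, hs₂, ← h₂, halt₁]; simp
  have hdep : ¬ LinearIndependent k ![v₀, v₁, v₂, v₃] := by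
    refine not_linearIndependent_of_isotropic halt₁ hdim hr₁ ?_
    intro i j
    fin_cases i <;> fin_cases j <;>
      simp [halt₁, h₀, h₁₂, h₂₃, h₁₃, hs₁ v₁ v₀, hs₁ v₂ v₀, hs₁ v₃ v₀, hs₁ v₂ v₁, hs₁ v₃ v₁,
        hs₁ v₃ v₂]
  rw [Fintype.not_linearIndependent_iff] at hdep
  obtain ⟨g, hg, i, hi⟩ := hdep
  simp only [Fin.sum_univ_four, Matrix.cons_val] at hg
  have hB : ω₂ (g 1 • v₀ + g 2 • v₁ + g 3 • v₂) = 0 := by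
    simpa [h₀, h₁, h₂, h₃] using congrArg ω₁ hg
  by_cases hg3 : g 3 = 0
  · exfalso
    rw [hg3, zero_smul, add_zero] at hB hg
    have hg2 : g 2 = 0 := by
      have := eq_zero_of_linear_radical hdim halt₁ halt₂ hrank (u₀ := -g 2 • v₀)
        (u₁ := g 1 • v₀ + g 2 • v₁) (by simp [h₀]) (by simp [h₀, h₁]) hB
      simpa [hv₀] using this
    rw [hg2, zero_smul, add_zero] at hB hg
    have hg1 : g 1 = 0 := by
      have := eq_zero_of_common_radical hdim halt₁ halt₂ hrank (v := g 1 • v₀) (by simp [h₀]) hB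
      simpa [hv₀] using this
    have hg0 : g 0 = 0 := by simpa [hg1, hv₀] using hg
    fin_cases i <;> contradiction
  · exact ⟨g 3 • v₀, g 1 • v₀ + g 2 • v₁ + g 3 • v₂, g 2 • v₀ + g 3 • v₁, by simp [hg3, hv₀],
      by simp [h₀], by simp [h₀, h₁], by simp [h₀, h₁, h₂], hB⟩

end RankFourPencil

/-- Let k be an algebraically closed field and F a 5-dimensional k-vector space.
Let ω₁, ω₂ be alternating bilinear forms on F such that every nonzero k-linear combination
α₁ω₁ + α₂ω₂ has rank 4. Then there is a basis (f₁,…,f₅) of F, with dual basis (f₁*,…,f₅*),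
such that ω₁ = f₂*∧f₄* + f₃*∧f₅* and ω₂ = f₁*∧f₅* + f₃*∧f₄*. -/
theorem codiagonalisation_of_rank_four_pencil
    (k : Type*) [Field k] [IsAlgClosed k]
    (F : Type*) [AddCommGroup F] [Module k F] [FiniteDimensional k F]
    (hdim : finrank k F = 5)
    (ω₁ ω₂ : F →ₗ[k] F →ₗ[k] k)
    (halt₁ : ∀ x, ω₁ x x = 0) (halt₂ : ∀ x, ω₂ x x = 0)
    (hrank : ∀ α₁ α₂ : k, (α₁, α₂) ≠ (0, 0) →
      finrank k (LinearMap.range (α₁ • ω₁ + α₂ • ω₂)) = 4) :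
    ∃ f : Basis (Fin 5) k F,
      ω₁ = wedge (f.coord 1) (f.coord 3) + wedge (f.coord 2) (f.coord 4) ∧
      ω₂ = wedge (f.coord 0) (f.coord 4) + wedge (f.coord 2) (f.coord 3) := by
  have hs₁ := alternating_swap halt₁
  have hs₂ := alternating_swap halt₂
  obtain ⟨f₁, f₂, f₃, hf₁, h₁, h₃₁, h₂₃, h₂⟩ :=
    exists_quadratic_radical hdim halt₁ halt₂ hrank
  have hf₂ : f₂ ≠ 0 := by
    rintro rfl
    have := eq_zero_of_linear_radical hdim halt₁ halt₂ hrank (u₀ := -f₁) (u₁ := f₃)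
      (by simp [h₁]) (by simp [h₃₁]) (by simp [← h₂₃])
    exact hf₁ (neg_eq_zero.1 this)
  have hpair : ∀ a b : k, a • ω₁ f₂ + b • ω₂ f₁ = 0 → a = 0 ∧ b = 0 := by
    intro a b hab
    have hb : b = 0 := by
      have h := eq_zero_of_linear_radical hdim halt₁ halt₂ hrank (u₀ := b • f₁)
        (u₁ := a • f₂) (by simp [h₁]) (by simpa using eq_neg_of_add_eq_zero_left hab)
        (by simp [h₂])
      simpa [hf₁] using h
    subst hb
    have h := eq_zero_of_common_radical hdim halt₁ halt₂ hrank (v := a • f₂)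
      (by simpa using hab) (by simp [h₂])
    exact ⟨by simpa [hf₂] using h, rfl⟩
  obtain ⟨x, y, hx₁, hx₂, hy₁, hy₂⟩ := exists_dual_pair hpair
  have h₂₃' : ω₁ f₂ f₃ = 0 := by rw [h₂₃, halt₂]
  have h₁₃' : ω₂ f₁ f₃ = 0 := by rw [← h₃₁, halt₁]
  have h₁₂' : ω₂ f₁ f₂ = 0 := by rw [hs₂, h₂]; simp
  have h₂₁' : ω₁ f₂ f₁ = 0 := by rw [hs₁, h₁]; simp
  obtain ⟨f₄, f₅, h₂₄, h₁₄, h₂₅, h₁₅, h₄₅, h₄₅'⟩ : ∃ f₄ f₅ : F, ω₁ f₂ f₄ = 1 ∧ ω₂ f₁ f₄ = 0 ∧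
      ω₁ f₂ f₅ = 0 ∧ ω₂ f₁ f₅ = 1 ∧ ω₁ f₄ f₅ = 0 ∧ ω₂ f₄ f₅ = 0 := by
    refine ⟨x, y + ω₁ x y • f₂ + ω₂ x y • f₃, hx₁, hx₂, ?_, ?_, ?_, ?_⟩
    · simp [hy₁, halt₁, h₂₃']
    · simp [hy₂, h₁₂', h₁₃']
    · simp [hs₁ x f₂, hs₁ x f₃, h₃₁, hx₁, hx₂]
    · simp [hs₂ x f₂, hs₂ x f₃, h₂, ← h₂₃, hx₁]
  have hli : LinearIndependent k ![f₁, f₂, f₃, f₄, f₅] := by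
    rw [Fintype.linearIndependent_iff]
    intro g hg
    simp only [Fin.sum_univ_five, Matrix.cons_val] at hg
    have hg3 : g 3 = 0 := by
      simpa [h₂₁', halt₁, h₂₃', h₂₄, h₂₅] using congrArg (ω₁ f₂) hg
    have hg4 : g 4 = 0 := by
      simpa [h₁₂', halt₂, h₁₃', h₁₄, h₁₅] using congrArg (ω₂ f₁) hg
    rw [hg3, hg4, zero_smul, zero_smul, add_zero, add_zero] at hg
    obtain ⟨hg1, hg2⟩ := hpair (g 1) (g 2) (by simpa [h₁, h₃₁] using congrArg ω₁ hg)
    have hg0 : g 0 = 0 := by simpa [hg1, hg2, hf₁] using hg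
    intro i
    fin_cases i <;> assumption
  obtain ⟨f, hf⟩ : ∃ f : Basis (Fin 5) k F, ∀ i, f i = ![f₁, f₂, f₃, f₄, f₅] i :=
    ⟨basisOfLinearIndependentOfCardEqFinrank hli (by simp [hdim]), fun i => by
      rw [coe_basisOfLinearIndependentOfCardEqFinrank]⟩
  refine ⟨f, alternating_ext_basis f halt₁ ?_ ?_, alternating_ext_basis f halt₂ ?_ ?_⟩
  · simp [wedge_self_apply]
  · intro i j hij
    simp only [LinearMap.add_apply, wedge_coord_apply]
    simp only [hf]
    fin_cases i <;> fin_cases j <;>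
      first
      | exact absurd hij (by decide)
      | simp [h₁, h₃₁, h₂₃', h₂₄, h₂₅, h₁₄, h₁₅, h₄₅]
  · simp [wedge_self_apply]
  · intro i j hij
    simp only [LinearMap.add_apply, wedge_coord_apply]
    simp only [hf]
    fin_cases i <;> fin_cases j <;>
      first
      | exact absurd hij (by decide)
      | simp [h₂, ← h₂₃, h₁₂', h₁₃', h₂₄, h₂₅, h₁₄, h₁₅, h₄₅']
end

section
/- Let k be an algebraically closed field and V a 4-dimensional k-vector space. For any two alternating bilinear forms ω₁, ω₂ on V there exists (α₁,α₂) ∈ k² with (α₁,α₂) ≠ (0,0) such that the form α₁ω₁ + α₂ω₂ is degenerate, i.e. the induced map L_{α₁ω₁+α₂ω₂} : V → V* has nontrivial kernel. -/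
open Module

/-- Over an algebraically closed field, any pencil of linear maps between nonzero spaces of the same
finite dimension contains a member with nontrivial kernel. -/
theorem LinearMap.exists_ker_smul_add_smul_ne_bot {k V W : Type*} [Field k] [IsAlgClosed k]
    [AddCommGroup V] [Module k V] [FiniteDimensional k V] [Nontrivial V]
    [AddCommGroup W] [Module k W] [FiniteDimensional k W]
    (hVW : finrank k V = finrank k W) (f g : V →ₗ[k] W) :
    ∃ a b : k, (a, b) ≠ (0, 0) ∧ LinearMap.ker (a • f + b • g) ≠ ⊥ := by
  by_cases hf : LinearMap.ker f = ⊥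
  · let e := LinearEquiv.ofInjectiveOfFinrankEq f (LinearMap.ker_eq_bot.mp hf) hVW
    obtain ⟨c, hc⟩ := Module.End.exists_eigenvalue (e.symm.toLinearMap ∘ₗ g)
    obtain ⟨x, hx⟩ := hc.exists_hasEigenvector
    have hgx : g x = c • f x := by
      have h : e.symm (g x) = c • x := hx.apply_eq_smul
      rw [LinearEquiv.symm_apply_eq, map_smul] at h
      exact h
    refine ⟨-c, 1, by simp, (Submodule.ne_bot_iff _).mpr ⟨x, ?_, hx.2⟩⟩
    simp [hgx]
  · exact ⟨1, 0, by simp, by simpa using hf⟩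

/-- Let k be an algebraically closed field and V a 4-dimensional k-vector space.
For any two alternating bilinear forms ω₁, ω₂ on V there exists (α₁,α₂) ≠ (0,0) in k² such that
α₁ω₁ + α₂ω₂ is degenerate, i.e. the induced map V → V* has nontrivial kernel. -/
theorem exists_degenerate_combination
    (k : Type*) [Field k] [IsAlgClosed k]
    (V : Type*) [AddCommGroup V] [Module k V] [FiniteDimensional k V]
    (hdim : finrank k V = 4)
    (ω₁ ω₂ : V →ₗ[k] V →ₗ[k] k)
    (halt₁ : ∀ x, ω₁ x x = 0) (halt₂ : ∀ x, ω₂ x x = 0) :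
    ∃ α₁ α₂ : k, (α₁, α₂) ≠ (0, 0) ∧
      LinearMap.ker (α₁ • ω₁ + α₂ • ω₂) ≠ ⊥ := by
  have : Nontrivial V := Module.nontrivial_of_finrank_pos (R := k) (by omega)
  exact LinearMap.exists_ker_smul_add_smul_ne_bot Subspace.dual_finrank_eq.symm ω₁ ω₂
end

section
/- Let k be a field, F a 5-dimensional k-vector space with basis (f₁,…,f₅) and dual basis (f₁*,…,f₅*), and set ω₁ = f₂*∧f₄* + f₃*∧f₅* and ω₂ = f₁*∧f₅* + f₃*∧f₄*. Suppose U ⊆ F is a 3-dimensional linear subspace such that g(U) = U for every g ∈ GL(F) satisfying ωᵢ(g x, g y) = ωᵢ(x,y) for all x,y ∈ F and i = 1,2. Then U = span(f₁, f₂, f₃). -/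
open Module

/-- The endomorphism of `F` with `f₄ ↦ a f₁ + b f₂ + c f₃`, `f₅ ↦ d f₁ + c f₂ + a f₃` that kills
`f₁, f₂, f₃`. -/
noncomputable def nilpotentShear {k F : Type*} [Field k] [AddCommGroup F] [Module k F]
    (B : Basis (Fin 5) k F) (a b c d : k) : F →ₗ[k] F :=
  (B.coord 3).smulRight (a • B 0 + b • B 1 + c • B 2) +
    (B.coord 4).smulRight (d • B 0 + c • B 1 + a • B 2)

lemma nilpotentShear_apply {k F : Type*} [Field k] [AddCommGroup F] [Module k F]
    (B : Basis (Fin 5) k F) (a b c d : k) (x : F) :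
    nilpotentShear B a b c d x =
      (B.coord 3 x * a + B.coord 4 x * d) • B 0 + (B.coord 3 x * b + B.coord 4 x * c) • B 1 +
        (B.coord 3 x * c + B.coord 4 x * a) • B 2 := by
  simp only [nilpotentShear, LinearMap.add_apply, LinearMap.smulRight_apply]
  module

lemma nilpotentShear_nilpotentShear {k F : Type*} [Field k] [AddCommGroup F] [Module k F]
    (B : Basis (Fin 5) k F) (a b c d a' b' c' d' : k) (x : F) :
    nilpotentShear B a b c d (nilpotentShear B a' b' c' d' x) = 0 := by
  rw [nilpotentShear_apply B a b c d, nilpotentShear_apply B a' b' c' d']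
  simp

/-- The unipotent automorphism `id + nilpotentShear B a b c d`. -/
noncomputable def shearEquiv {k F : Type*} [Field k] [AddCommGroup F] [Module k F]
    (B : Basis (Fin 5) k F) (a b c d : k) : F ≃ₗ[k] F :=
  LinearEquiv.ofLinearMap (LinearMap.id + nilpotentShear B a b c d)
    (LinearMap.id - nilpotentShear B a b c d)
    (by ext x; simp [nilpotentShear_nilpotentShear])
    (by ext x; simp [nilpotentShear_nilpotentShear])

lemma shearEquiv_apply {k F : Type*} [Field k] [AddCommGroup F] [Module k F]
    (B : Basis (Fin 5) k F) (a b c d : k) (x : F) :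
    shearEquiv B a b c d x = x + nilpotentShear B a b c d x := rfl

lemma wedge_apply {k F : Type*} [Field k] [AddCommGroup F] [Module k F]
    (φ ψ : F →ₗ[k] k) (x y : F) : wedge φ ψ x y = φ x * ψ y - ψ x * φ y := rfl

/-- Let k be a field, F a 5-dimensional k-vector space with basis (f₁,…,f₅) and
dual basis (f₁*,…,f₅*), and set ω₁ = f₂*∧f₄* + f₃*∧f₅* and ω₂ = f₁*∧f₅* + f₃*∧f₄*. If U ⊆ F is
a 3-dimensional linear subspace with g(U) = U for every g ∈ GL(F) preserving both ω₁ and ω₂,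
then U = span(f₁, f₂, f₃). -/
theorem stabilized_threespace_unique
    (k : Type*) [Field k]
    (F : Type*) [AddCommGroup F] [Module k F]
    (B : Basis (Fin 5) k F)
    (ω₁ ω₂ : F →ₗ[k] F →ₗ[k] k)
    (hω₁ : ω₁ = wedge (B.coord 1) (B.coord 3) + wedge (B.coord 2) (B.coord 4))
    (hω₂ : ω₂ = wedge (B.coord 0) (B.coord 4) + wedge (B.coord 2) (B.coord 3))
    (U : Submodule k F) (hU3 : finrank k U = 3)
    (hstab : ∀ g : F ≃ₗ[k] F,
      (∀ x y, ω₁ (g x) (g y) = ω₁ x y) →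
      (∀ x y, ω₂ (g x) (g y) = ω₂ x y) →
      U.map g.toLinearMap = U) :
    U = Submodule.span k {B 0, B 1, B 2} := by
  have hN (a b c d : k) {u : F} (hu : u ∈ U) : nilpotentShear B a b c d u ∈ U := by
    have hU : U.map (shearEquiv B a b c d).toLinearMap = U := by
      apply hstab <;> intro x y
      all_goals
        simp only [hω₁, hω₂, LinearMap.add_apply, wedge_apply]
        simp [shearEquiv_apply, nilpotentShear_apply]
        ring
    have hg : shearEquiv B a b c d u ∈ U := hU ▸ Submodule.mem_map_of_mem hu
    rw [shearEquiv_apply] at hg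
    exact (Submodule.add_mem_iff_right U hu).1 hg
  have hfin : FiniteDimensional k F := B.finiteDimensional_of_finite
  have hspan : finrank k (Submodule.span k {B 0, B 1, B 2}) = 3 := by
    have hli : LinearIndependent k (B ∘ (Fin.castLE (by norm_num : 3 ≤ 5))) :=
      B.linearIndependent.comp _ (Fin.castLE_injective _)
    have h := finrank_span_eq_card hli
    have hr : Set.range (B ∘ (Fin.castLE (by norm_num : 3 ≤ 5))) = {B 0, B 1, B 2} := by
      ext v
      simp [Fin.exists_fin_succ, eq_comm]
    rwa [hr, Fintype.card_fin] at h
  by_cases hle : U ≤ Submodule.span k {B 0, B 1, B 2}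
  · exact Submodule.eq_of_le_of_finrank_eq hle (hU3.trans hspan.symm)
  obtain ⟨u, hu, hus⟩ := SetLike.not_le_iff_exists.1 hle
  refine (Submodule.eq_of_le_of_finrank_eq ?_ (hspan.trans hU3.symm)).symm
  have mem_of_shear {v : F} (a b c d : k) (h : nilpotentShear B a b c d u = v) : v ∈ U :=
    h ▸ hN a b c d hu
  simp only [nilpotentShear_apply] at mem_of_shear
  rw [Submodule.span_le]
  by_cases h3 : B.coord 3 u = 0
  · have h4 : B.coord 4 u ≠ 0 := by
      intro h4
      apply hus
      rw [← B.sum_repr u]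
      rw [B.coord_apply] at h3 h4
      simp only [Fin.sum_univ_five, h3, h4, zero_smul, add_zero]
      refine add_mem (add_mem ?_ ?_) ?_ <;>
        exact Submodule.smul_mem _ _ (Submodule.subset_span (by simp))
    set y := B.coord 4 u
    rintro v (rfl | rfl | rfl)
    · exact mem_of_shear 0 0 0 y⁻¹ (by simp [h3, h4])
    · exact mem_of_shear 0 0 y⁻¹ 0 (by simp [h3, h4])
    · exact mem_of_shear y⁻¹ 0 0 0 (by simp [h3, h4])
  · set x := B.coord 3 u
    set y := B.coord 4 u
    rintro v (rfl | rfl | rfl)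
    · refine mem_of_shear x⁻¹ (y ^ 2 / x ^ 3) (-y / x ^ 2) 0 ?_
      have e1 : x * (y ^ 2 / x ^ 3) + y * (-y / x ^ 2) = 0 := by field_simp; ring
      have e2 : x * (-y / x ^ 2) + y * x⁻¹ = 0 := by field_simp; ring
      simp [e1, e2, h3]
    · exact mem_of_shear 0 x⁻¹ 0 0 (by simp [h3])
    · refine mem_of_shear 0 (-y / x ^ 2) x⁻¹ 0 ?_
      have e : x * (-y / x ^ 2) + y * x⁻¹ = 0 := by field_simp; ring
      simp [e, h3]
end

section
/- Let k be an algebraically closed field of characteristic different from 2, V a k-vector space of dimension 1 or 2, N a quadratic form on V whose polar bilinear form is nondegenerate, and x₀ ∈ V with N(x₀) = 1. Then there exists exactly one k-bilinear map m : V × V → V such that m(x₀,v) = v and m(v,x₀) = v for all v ∈ V, and N(m(u,v)) = N(u)·N(v) for all u,v ∈ V. -/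
open Module

/-- A nondegenerate quadratic space of dimension one or two with a vector `x₀` of norm one is
spanned by `x₀` and a vector orthogonal to `x₀` that is either zero or anisotropic. -/
theorem exists_orthogonal_spanning_vector
    {k V : Type*} [Field k] (hchar : (2 : k) ≠ 0)
    [AddCommGroup V] [Module k V] [FiniteDimensional k V]
    (hdim : finrank k V = 1 ∨ finrank k V = 2)
    (N : QuadraticForm k V) (hN : N.polarBilin.Nondegenerate)
    (x₀ : V) (hx₀ : N x₀ = 1) :
    ∃ y : V, QuadraticMap.polar N x₀ y = 0 ∧ (y = 0 ∨ N y ≠ 0) ∧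
      ∀ v, ∃ a b : k, v = a • x₀ + b • y := by
  have hx : x₀ ≠ 0 := by
    rintro rfl
    simp at hx₀
  rcases hdim with h1 | h2
  · refine ⟨0, QuadraticMap.polar_zero_right N x₀, Or.inl rfl, fun v => ?_⟩
    obtain ⟨c, hc⟩ := (finrank_eq_one_iff_of_nonzero' x₀ hx).1 h1 v
    exact ⟨c, 0, by simp [hc]⟩
  · have hker : LinearMap.ker (N.polarBilin x₀) ≠ ⊥ :=
      LinearMap.ker_ne_bot_of_finrank_lt (by simp [h2])
    obtain ⟨y, hy, hy0⟩ := Submodule.exists_mem_ne_zero_of_ne_bot hker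
    have hxy : QuadraticMap.polar N x₀ y = 0 := hy
    have hspan : ∀ v, ∃ a b : k, v = a • x₀ + b • y := by
      have hli : LinearIndependent k ![x₀, y] := by
        rw [LinearIndependent.pair_iff]
        intro s t hst
        have hs : s = 0 := by
          have h := congrArg (QuadraticMap.polar N x₀) hst
          simpa [QuadraticMap.polar_add_right, QuadraticMap.polar_smul_right, hxy,
            QuadraticMap.polar_self, hx₀, hchar] using h
        refine ⟨hs, ?_⟩
        simpa [hs, hy0] using hst
      have htop := hli.span_eq_top_of_card_eq_finrank' (by simp [h2])
      intro v
      have hv : v ∈ Submodule.span k (Set.range ![x₀, y]) := htop ▸ Submodule.mem_top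
      rw [Matrix.range_cons, Matrix.range_cons, Matrix.range_empty, Set.union_empty,
        Set.singleton_union, Submodule.mem_span_pair] at hv
      obtain ⟨a, b, h⟩ := hv
      exact ⟨a, b, h.symm⟩
    refine ⟨y, hxy, Or.inr fun hNy => hy0 ?_, hspan⟩
    refine hN.1 y fun v => ?_
    obtain ⟨a, b, rfl⟩ := hspan v
    simp [QuadraticMap.polar_add_right, QuadraticMap.polar_smul_right,
      QuadraticMap.polar_comm N y x₀, hxy, QuadraticMap.polar_self, hNy]

/-- The norm of a combination of a norm one vector and a vector orthogonal to it. -/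
theorem quadraticForm_smul_add_smul_of_polar_eq_zero
    {k V : Type*} [Field k] [AddCommGroup V] [Module k V] (N : QuadraticForm k V) {x₀ y : V}
    (hx₀ : N x₀ = 1) (hxy : QuadraticMap.polar N x₀ y = 0) (a b : k) :
    N (a • x₀ + b • y) = a ^ 2 + b ^ 2 * N y := by
  rw [QuadraticMap.map_add N, QuadraticMap.polar_smul_left, QuadraticMap.polar_smul_right, hxy,
    QuadraticMap.map_smul, QuadraticMap.map_smul, hx₀]
  simp only [smul_eq_mul]
  ring

/-- In a unital multiplication permitting composition, a vector orthogonal to the unit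
squares to minus its norm. -/
theorem composition_mul_self_of_polar_eq_zero
    {k V : Type*} [Field k] (hchar : (2 : k) ≠ 0) [AddCommGroup V] [Module k V]
    (N : QuadraticForm k V) {x₀ y : V} (hx₀ : N x₀ = 1)
    (hxy : QuadraticMap.polar N x₀ y = 0) (hy : y = 0 ∨ N y ≠ 0)
    (hspan : ∀ v, ∃ a b : k, v = a • x₀ + b • y)
    (m : V →ₗ[k] V →ₗ[k] V) (hl : ∀ v, m x₀ v = v) (hr : ∀ v, m v x₀ = v)
    (hm : ∀ u v, N (m u v) = N u * N v) :
    m y y = -(N y) • x₀ := by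
  rcases hy with rfl | hn
  · simp
  have hf := quadraticForm_smul_add_smul_of_polar_eq_zero N hx₀ hxy
  obtain ⟨p, q, hpq⟩ := hspan (m y y)
  have e1 : p ^ 2 + q ^ 2 * N y = N y * N y := by rw [← hf, ← hpq, hm]
  have e2 : p ^ 2 + (1 + q) ^ 2 * N y = (1 + N y) * N y := by
    have h := hm ((1 : k) • x₀ + (1 : k) • y) y
    have h' : m ((1 : k) • x₀ + (1 : k) • y) y = p • x₀ + (1 + q) • y := by
      simp only [map_add, LinearMap.add_apply, one_smul, hl, hpq]
      module
    rw [h', hf, hf] at h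
    linear_combination h
  have e3 : (1 + p) ^ 2 + (2 + q) ^ 2 * N y = (1 + N y) ^ 2 := by
    have h := hm ((1 : k) • x₀ + (1 : k) • y) ((1 : k) • x₀ + (1 : k) • y)
    have h' : m ((1 : k) • x₀ + (1 : k) • y) ((1 : k) • x₀ + (1 : k) • y)
        = (1 + p) • x₀ + (2 + q) • y := by
      simp only [map_add, LinearMap.add_apply, one_smul, hl, hr, hpq]
      module
    rw [h', hf, hf] at h
    linear_combination h
  have hq : q = 0 := by
    have h : 2 * N y * q = 0 := by linear_combination e2 - e1
    simpa [hchar, hn] using h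
  subst hq
  have hp : p = -N y := by
    apply mul_left_cancel₀ hchar
    linear_combination e3 - e1
  rw [hpq, hp, zero_smul, add_zero]

/-- Let k be an algebraically closed field of characteristic ≠ 2, V a k-vector
space of dimension 1 or 2, N a quadratic form on V whose polar bilinear form is nondegenerate,
and x₀ ∈ V with N(x₀) = 1. Then there is exactly one k-bilinear map m : V × V → V such that x₀
is a two-sided unit for m and N(m(u,v)) = N(u)·N(v) for all u,v ∈ V. -/
theorem unique_composition_algebra_structure_dim_one_or_two
    (k : Type*) [Field k] [IsAlgClosed k] (hchar : (2 : k) ≠ 0)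
    (V : Type*) [AddCommGroup V] [Module k V] [FiniteDimensional k V]
    (hdim : finrank k V = 1 ∨ finrank k V = 2)
    (N : QuadraticForm k V)
    (hN : N.polarBilin.Nondegenerate)
    (x₀ : V) (hx₀ : N x₀ = 1) :
    ∃! m : V →ₗ[k] V →ₗ[k] V,
      (∀ v, m x₀ v = v) ∧ (∀ v, m v x₀ = v) ∧
      (∀ u v, N (m u v) = N u * N v) := by
  obtain ⟨y, hxy, hy, hspan⟩ := exists_orthogonal_spanning_vector hchar hdim N hN x₀ hx₀
  have hf := quadraticForm_smul_add_smul_of_polar_eq_zero N hx₀ hxy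
  have hyx : QuadraticMap.polar N y x₀ = 0 := by rw [QuadraticMap.polar_comm, hxy]
  have hxx : QuadraticMap.polar N x₀ x₀ = 2 := by simp [QuadraticMap.polar_self, hx₀]
  have hyy : QuadraticMap.polar N y y = 2 * N y := by simp [QuadraticMap.polar_self]
  let t : V →ₗ[k] k := N.polarBilin x₀
  let S : V →ₗ[k] V →ₗ[k] V := (LinearMap.lsmul k V).comp t
  let m : V →ₗ[k] V →ₗ[k] V :=
    (2 : k)⁻¹ • (S + S.flip - N.polarBilin.compr₂ (LinearMap.toSpanSingleton k V x₀))
  have hm : ∀ u v, m u v = (2 : k)⁻¹ • (QuadraticMap.polar N x₀ u • v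
      + QuadraticMap.polar N x₀ v • u - QuadraticMap.polar N u v • x₀) := fun u v => rfl
  have hmul : ∀ a b c d : k, m (a • x₀ + b • y) (c • x₀ + d • y)
      = (a * c - b * d * N y) • x₀ + (a * d + b * c) • y := by
    intro a b c d
    rw [hm]
    simp only [QuadraticMap.polar_add_left, QuadraticMap.polar_add_right,
      QuadraticMap.polar_smul_left, QuadraticMap.polar_smul_right, hxy, hyx, hxx, hyy,
      smul_eq_mul]
    match_scalars <;> field_simp <;> ring
  refine ⟨m, ⟨fun v => ?_, fun v => ?_, fun u v => ?_⟩, ?_⟩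
  · obtain ⟨a, b, rfl⟩ := hspan v
    simpa using hmul 1 0 a b
  · obtain ⟨a, b, rfl⟩ := hspan v
    simpa using hmul a b 1 0
  · obtain ⟨a, b, rfl⟩ := hspan u
    obtain ⟨c, d, rfl⟩ := hspan v
    rw [hmul, hf, hf, hf]
    ring
  · rintro m' ⟨hl, hr, hc⟩
    have hsq := composition_mul_self_of_polar_eq_zero hchar N hx₀ hxy hy hspan m' hl hr hc
    ext u v
    obtain ⟨a, b, rfl⟩ := hspan u
    obtain ⟨c, d, rfl⟩ := hspan v
    rw [hmul]
    simp only [map_add, map_smul, LinearMap.add_apply, LinearMap.smul_apply, hl, hr, hsq]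
    module
end

section
/- Let k be an algebraically closed field of characteristic different from 2, V a 4-dimensional k-vector space, N a quadratic form on V whose polar bilinear form is nondegenerate, and x₀ ∈ V with N(x₀) = 1. Then there exist exactly two k-bilinear maps m : V × V → V such that m(x₀,v) = v and m(v,x₀) = v for all v ∈ V, and N(m(u,v)) = N(u)·N(v) for all u,v ∈ V. -/
open Module Quaternion

namespace Quaternion

variable {k : Type*}

section CommRing

variable [CommRing k]

/-- The standard symmetric bilinear form on the quaternions, of which `normSq` is the
quadratic form. -/
def dot (x y : ℍ[k]) : k := x.re * y.re + x.imI * y.imI + x.imJ * y.imJ + x.imK * y.imK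

theorem dot_comm (x y : ℍ[k]) : dot x y = dot y x := by
  simp only [dot]; ring

theorem dot_add_left (x y z : ℍ[k]) : dot (x + y) z = dot x z + dot y z := by
  simp only [dot, re_add, imI_add, imJ_add, imK_add]; ring

theorem dot_add_right (x y z : ℍ[k]) : dot x (y + z) = dot x y + dot x z := by
  simp only [dot, re_add, imI_add, imJ_add, imK_add]; ring

theorem dot_smul_left (c : k) (x z : ℍ[k]) : dot (c • x) z = c * dot x z := by
  simp only [dot, re_smul, imI_smul, imJ_smul, imK_smul, smul_eq_mul]; ring

theorem dot_self (x : ℍ[k]) : dot x x = normSq x := by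
  rw [normSq_def', dot]; ring

theorem normSq_add_eq (x y : ℍ[k]) : normSq (x + y) = normSq x + normSq y + 2 * dot x y := by
  simp only [normSq_def', dot, re_add, imI_add, imJ_add, imK_add]; ring

theorem eq_of_forall_dot_eq {x y : ℍ[k]} (h : ∀ w, dot x w = dot y w) : x = y := by
  ext
  · simpa [dot] using h ⟨1, 0, 0, 0⟩
  · simpa [dot] using h ⟨0, 1, 0, 0⟩
  · simpa [dot] using h ⟨0, 0, 1, 0⟩
  · simpa [dot] using h ⟨0, 0, 0, 1⟩

end CommRing

section Composition

variable [Field k] {m : ℍ[k] →ₗ[k] ℍ[k] →ₗ[k] ℍ[k]}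

theorem dot_map_add_dot_map (h2 : (2 : k) ≠ 0)
    (hm : ∀ u v, normSq (m u v) = normSq u * normSq v) (u v x y : ℍ[k]) :
    dot (m u x) (m v y) + dot (m v x) (m u y) = 2 * dot u v * dot x y := by
  have h := hm (u + v) (x + y)
  have h₁ := hm (u + v) x
  have h₂ := hm (u + v) y
  have h₃ := hm u (x + y)
  have h₄ := hm v (x + y)
  simp only [map_add, LinearMap.add_apply, normSq_add_eq, dot_add_left, dot_add_right,
    hm] at h h₁ h₂ h₃ h₄
  apply mul_left_cancel₀ h2
  linear_combination h - h₁ - h₂ - h₃ - h₄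

theorem dot_map_left (h2 : (2 : k) ≠ 0)
    (hm : ∀ u v, normSq (m u v) = normSq u * normSq v) (u x y : ℍ[k]) :
    dot (m u x) (m u y) = normSq u * dot x y := by
  apply mul_left_cancel₀ h2
  have := dot_map_add_dot_map h2 hm u u x y
  rw [dot_self] at this
  linear_combination this

theorem dot_map_right (h2 : (2 : k) ≠ 0)
    (hm : ∀ u v, normSq (m u v) = normSq u * normSq v) (u v x : ℍ[k]) :
    dot (m u x) (m v x) = dot u v * normSq x := by
  apply mul_left_cancel₀ h2
  have := dot_map_add_dot_map h2 hm u v x x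
  rw [dot_self, dot_comm (m v x)] at this
  linear_combination this

theorem map_map_of_dot_one_eq_zero (h2 : (2 : k) ≠ 0)
    (hm : ∀ u v, normSq (m u v) = normSq u * normSq v) (h1 : ∀ v, m 1 v = v)
    {u : ℍ[k]} (hu : dot u 1 = 0) (v : ℍ[k]) : m u (m u v) = -normSq u • v := by
  refine eq_of_forall_dot_eq fun w => ?_
  have := dot_map_add_dot_map h2 hm u 1 (m u v) w
  rw [h1, h1, hu, dot_map_left h2 hm] at this
  rw [dot_smul_left]
  linear_combination this

theorem map_map_of_dot_one_eq_zero' (h2 : (2 : k) ≠ 0)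
    (hm : ∀ u v, normSq (m u v) = normSq u * normSq v) (h1 : ∀ v, m v 1 = v)
    {u : ℍ[k]} (hu : dot u 1 = 0) (v : ℍ[k]) : m (m v u) u = -normSq u • v := by
  refine map_map_of_dot_one_eq_zero (m := m.flip) h2 (fun x y => ?_) h1 hu v
  rw [LinearMap.flip_apply, hm, mul_comm]

theorem map_self_of_dot_one_eq_zero (h2 : (2 : k) ≠ 0)
    (hm : ∀ u v, normSq (m u v) = normSq u * normSq v) (h1 : ∀ v, m 1 v = v)
    (h1' : ∀ v, m v 1 = v) {u : ℍ[k]} (hu : dot u 1 = 0) : m u u = -normSq u • 1 := by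
  simpa [h1'] using map_map_of_dot_one_eq_zero h2 hm h1 hu 1

theorem map_swap_of_dot_eq_zero (h2 : (2 : k) ≠ 0)
    (hm : ∀ u v, normSq (m u v) = normSq u * normSq v) (h1 : ∀ v, m 1 v = v)
    (h1' : ∀ v, m v 1 = v) {u v : ℍ[k]} (hu : dot u 1 = 0) (hv : dot v 1 = 0)
    (huv : dot u v = 0) : m v u = -m u v := by
  have h := map_self_of_dot_one_eq_zero h2 hm h1 h1' (u := u + v)
    (by rw [dot_add_left, hu, hv, add_zero])
  rw [normSq_add_eq, huv, map_add, map_add, LinearMap.add_apply, LinearMap.add_apply,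
    map_self_of_dot_one_eq_zero h2 hm h1 h1' hu, map_self_of_dot_one_eq_zero h2 hm h1 h1' hv] at h
  rw [eq_neg_iff_add_eq_zero, ← sub_eq_zero.mpr h]
  module

/-- A composition multiplication on the quaternions with unit `1` is either the quaternion
multiplication or its opposite. -/
theorem eq_mul_or_eq_flip_mul (h2 : (2 : k) ≠ 0)
    (hm : ∀ u v, normSq (m u v) = normSq u * normSq v) (h1 : ∀ v, m 1 v = v)
    (h1' : ∀ v, m v 1 = v) :
    m = LinearMap.mul k ℍ[k] ∨ m = (LinearMap.mul k ℍ[k]).flip := by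
  obtain ⟨i, i₀, i₁, i₂, i₃⟩ : ∃ q : ℍ[k], q.re = 0 ∧ q.imI = 1 ∧ q.imJ = 0 ∧ q.imK = 0 :=
    ⟨⟨0, 1, 0, 0⟩, rfl, rfl, rfl, rfl⟩
  obtain ⟨j, j₀, j₁, j₂, j₃⟩ : ∃ q : ℍ[k], q.re = 0 ∧ q.imI = 0 ∧ q.imJ = 1 ∧ q.imK = 0 :=
    ⟨⟨0, 0, 1, 0⟩, rfl, rfl, rfl, rfl⟩
  obtain ⟨l, l₀, l₁, l₂, l₃⟩ : ∃ q : ℍ[k], q.re = 0 ∧ q.imI = 0 ∧ q.imJ = 0 ∧ q.imK = 1 :=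
    ⟨⟨0, 0, 0, 1⟩, rfl, rfl, rfl, rfl⟩
  have i1 : dot i 1 = 0 := by simp [dot, *]
  have j1 : dot j 1 = 0 := by simp [dot, *]
  have l1 : dot l 1 = 0 := by simp [dot, *]
  have ij : dot i j = 0 := by simp [dot, *]
  have il : dot i l = 0 := by simp [dot, *]
  have jl : dot j l = 0 := by simp [dot, *]
  have ni : normSq i = 1 := by simp [normSq_def', *]
  have nj : normSq j = 1 := by simp [normSq_def', *]
  have nl : normSq l = 1 := by simp [normSq_def', *]
  have hii : m i i = -1 := by simpa [ni] using map_self_of_dot_one_eq_zero h2 hm h1 h1' i1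
  have hjj : m j j = -1 := by simpa [nj] using map_self_of_dot_one_eq_zero h2 hm h1 h1' j1
  have hll : m l l = -1 := by simpa [nl] using map_self_of_dot_one_eq_zero h2 hm h1 h1' l1
  have hji := map_swap_of_dot_eq_zero h2 hm h1 h1' i1 j1 ij
  have hli := map_swap_of_dot_eq_zero h2 hm h1 h1' i1 l1 il
  have hlj := map_swap_of_dot_eq_zero h2 hm h1 h1' j1 l1 jl
  obtain ⟨c, hc⟩ : ∃ c : k, m i j = c • l := by
    have hdi : dot (m i j) i = 0 := by
      simpa [h1', j1] using dot_map_left h2 hm i j 1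
    have hdj : dot (m i j) j = 0 := by
      simpa [h1, i1] using dot_map_right h2 hm i 1 j
    have hd1 : dot (m i j) 1 = 0 := by
      simpa [h1, h1', i1, dot_comm j i, ij] using dot_map_add_dot_map h2 hm i 1 j 1
    simp only [dot, i₀, i₁, i₂, i₃, j₀, j₁, j₂, j₃, re_one, imI_one, imJ_one, imK_one, mul_zero,
      mul_one, add_zero, zero_add] at hdi hdj hd1
    exact ⟨(m i j).imK, by ext <;> simp [hdi, hdj, hd1, l₀, l₁, l₂, l₃]⟩
  have hcc : c * c = 1 := by
    have := hm i j
    rw [hc, normSq_smul, ni, nj, nl] at this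
    linear_combination this
  have hil : m i l = -c • j := by
    have := map_map_of_dot_one_eq_zero h2 hm h1 i1 j
    rw [hc, map_smul, ni] at this
    rw [← one_smul k (m i l), ← hcc, mul_smul, this]
    simp
  have hlj' : m l j = -c • i := by
    have := map_map_of_dot_one_eq_zero' h2 hm h1' j1 i
    rw [hc, map_smul, LinearMap.smul_apply, nj] at this
    rw [← one_smul k (m l j), ← hcc, mul_smul, this]
    simp
  have hjl : m j l = c • i := by
    rw [← neg_neg (m j l), ← hlj, hlj']; simp
  rw [hc] at hji
  rw [hil] at hli
  have hext {M : Type _} [AddCommGroup M] [Module k M] {f g : ℍ[k] →ₗ[k] M} (e₀ : f 1 = g 1)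
      (e₁ : f i = g i) (e₂ : f j = g j) (e₃ : f l = g l) : f = g := by
    ext1 q
    rw [show q = q.re • 1 + q.imI • i + q.imJ • j + q.imK • l by ext <;> simp [*]]
    simp only [map_add, map_smul, e₀, e₁, e₂, e₃]
  rcases mul_self_eq_one_iff.mp hcc with rfl | rfl
  · left
    apply hext <;> apply hext <;>
      simp only [h1, h1', hii, hjj, hll, hc, hil, hji, hjl, hli, hlj', LinearMap.mul_apply'] <;>
      ext <;> simp [i₀, i₁, i₂, i₃, j₀, j₁, j₂, j₃, l₀, l₁, l₂, l₃]
  · right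
    apply hext <;> apply hext <;>
      simp only [h1, h1', hii, hjj, hll, hc, hil, hji, hjl, hli, hlj', LinearMap.flip_apply,
        LinearMap.mul_apply'] <;>
      ext <;> simp [i₀, i₁, i₂, i₃, j₀, j₁, j₂, j₃, l₀, l₁, l₂, l₃]

theorem mul_ne_flip_mul (h2 : (2 : k) ≠ 0) :
    LinearMap.mul k ℍ[k] ≠ (LinearMap.mul k ℍ[k]).flip := fun h => by
  obtain ⟨i, i₀, i₁, i₂, i₃⟩ : ∃ q : ℍ[k], q.re = 0 ∧ q.imI = 1 ∧ q.imJ = 0 ∧ q.imK = 0 :=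
    ⟨⟨0, 1, 0, 0⟩, rfl, rfl, rfl, rfl⟩
  obtain ⟨j, j₀, j₁, j₂, j₃⟩ : ∃ q : ℍ[k], q.re = 0 ∧ q.imI = 0 ∧ q.imJ = 1 ∧ q.imK = 0 :=
    ⟨⟨0, 0, 1, 0⟩, rfl, rfl, rfl, rfl⟩
  have h : i * j = j * i := LinearMap.congr_fun₂ h i j
  have h := congrArg QuaternionAlgebra.imK h
  rw [imK_mul, imK_mul, i₀, i₁, i₂, i₃, j₀, j₁, j₂, j₃] at h
  exact h2 (by linear_combination h)

end Composition

end Quaternion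

open QuadraticMap in
/-- A vector of norm `1` in a nondegenerate four-dimensional quadratic space over an algebraically
closed field becomes the unit under a suitable isometry with the quaternions. -/
theorem QuadraticForm.exists_linearEquiv_quaternion {k : Type*} [Field k] [IsAlgClosed k]
    (hchar : (2 : k) ≠ 0) {V : Type*} [AddCommGroup V] [Module k V] [FiniteDimensional k V]
    (hdim : finrank k V = 4) (N : QuadraticForm k V) (hN : N.polarBilin.Nondegenerate)
    {x₀ : V} (hx₀ : N x₀ = 1) :
    ∃ φ : V ≃ₗ[k] ℍ[k], φ x₀ = 1 ∧ ∀ v, normSq (φ v) = N v := by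
  let : Invertible (2 : k) := invertibleOfNonzero hchar
  have hs : (associated N).SeparatingLeft := fun x hx => hN.1 x fun y => by
    rw [← two_nsmul_associated k N, LinearMap.smul_apply, LinearMap.smul_apply, hx y, smul_zero]
  obtain ⟨f⟩ := equivalent_weightedSumSquares_of_isAlgClosed N hs
  rw [hdim] at f
  let ψ : V ≃ₗ[k] ℍ[k] := f.toLinearEquiv.trans (QuaternionAlgebra.linearEquivTuple _ _ _).symm
  have hψ (v : V) : normSq (ψ v) = N v := by
    rw [← f.map_app v, normSq_def']
    change f v 0 ^ 2 + f v 1 ^ 2 + f v 2 ^ 2 + f v 3 ^ 2 = _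
    rw [weightedSumSquares_apply, Fin.sum_univ_four]
    simp [pow_two]
  have h₁ : ψ x₀ * star (ψ x₀) = 1 := by rw [self_mul_star, hψ, hx₀, coe_one]
  have h₂ : star (ψ x₀) * ψ x₀ = 1 := by rw [star_mul_self, hψ, hx₀, coe_one]
  let e : ℍ[k] ≃ₗ[k] ℍ[k] :=
    LinearEquiv.ofLinearMap (LinearMap.mulLeft k (star (ψ x₀))) (LinearMap.mulLeft k (ψ x₀))
      (by rw [← LinearMap.mulLeft_mul, h₂, LinearMap.mulLeft_one])
      (by rw [← LinearMap.mulLeft_mul, h₁, LinearMap.mulLeft_one])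
  have he (q : ℍ[k]) : e q = star (ψ x₀) * q := rfl
  refine ⟨ψ.trans e, ?_, fun v => ?_⟩
  · rw [LinearEquiv.trans_apply, he, h₂]
  · rw [LinearEquiv.trans_apply, he, map_mul, normSq_star, hψ, hψ, hx₀, one_mul]

/-- Let k be an algebraically closed field of characteristic ≠ 2, V a
4-dimensional k-vector space, N a quadratic form on V whose polar bilinear form is
nondegenerate, and x₀ ∈ V with N(x₀) = 1. Then there are exactly two k-bilinear maps
m : V × V → V such that x₀ is a two-sided unit for m and N(m(u,v)) = N(u)·N(v)
for all u,v ∈ V. -/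
theorem two_composition_algebra_structures_dim_four
    (k : Type*) [Field k] [IsAlgClosed k] (hchar : (2 : k) ≠ 0)
    (V : Type*) [AddCommGroup V] [Module k V] [FiniteDimensional k V]
    (hdim : finrank k V = 4)
    (N : QuadraticForm k V)
    (hN : N.polarBilin.Nondegenerate)
    (x₀ : V) (hx₀ : N x₀ = 1) :
    ∃ m₁ m₂ : V →ₗ[k] V →ₗ[k] V, m₁ ≠ m₂ ∧
      ((∀ v, m₁ x₀ v = v) ∧ (∀ v, m₁ v x₀ = v) ∧ (∀ u v, N (m₁ u v) = N u * N v)) ∧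
      ((∀ v, m₂ x₀ v = v) ∧ (∀ v, m₂ v x₀ = v) ∧ (∀ u v, N (m₂ u v) = N u * N v)) ∧
      (∀ m : V →ₗ[k] V →ₗ[k] V,
        ((∀ v, m x₀ v = v) ∧ (∀ v, m v x₀ = v) ∧ (∀ u v, N (m u v) = N u * N v)) →
        m = m₁ ∨ m = m₂) := by
  obtain ⟨φ, h1, hφ⟩ := N.exists_linearEquiv_quaternion hchar hdim hN hx₀
  let T : (ℍ[k] →ₗ[k] ℍ[k] →ₗ[k] ℍ[k]) → V →ₗ[k] V →ₗ[k] V :=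
    fun m => (m.compl₁₂ φ.toLinearMap φ.toLinearMap).compr₂ φ.symm.toLinearMap
  have hT (m u v) : T m u v = φ.symm (m (φ u) (φ v)) := rfl
  refine ⟨T (LinearMap.mul k ℍ[k]), T (LinearMap.mul k ℍ[k]).flip, fun h => ?_,
    ⟨fun v => ?_, fun v => ?_, fun u v => ?_⟩, ⟨fun v => ?_, fun v => ?_, fun u v => ?_⟩,
    fun m ⟨hl, hr, hm⟩ => ?_⟩
  · refine mul_ne_flip_mul hchar (LinearMap.ext₂ fun x y => ?_)
    have h := LinearMap.congr_fun₂ h (φ.symm x) (φ.symm y)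
    rwa [hT, hT, φ.apply_symm_apply, φ.apply_symm_apply, φ.symm.injective.eq_iff] at h
  · simp [hT, h1]
  · simp [hT, h1]
  · simp [hT, ← hφ]
  · simp [hT, h1]
  · simp [hT, h1]
  · simp [hT, ← hφ, mul_comm]
  · let m' : ℍ[k] →ₗ[k] ℍ[k] →ₗ[k] ℍ[k] :=
      (m.compl₁₂ φ.symm.toLinearMap φ.symm.toLinearMap).compr₂ φ.toLinearMap
    have h1' : φ.symm 1 = x₀ := by rw [← h1, φ.symm_apply_apply]
    have hm' : m = T m' := by
      ext u v
      simp [hT, m']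
    rw [hm']
    refine (eq_mul_or_eq_flip_mul (m := m') hchar (fun u v => ?_) (fun v => ?_)
      fun v => ?_).imp (congrArg T) (congrArg T)
    · simp [m', hφ, hm, ← hφ (φ.symm _)]
    · simp [m', h1', hl]
    · simp [m', h1', hr]
end

section
/- Let k be a field and F a 5-dimensional k-vector space. Let ω, ω' be linearly independent alternating bilinear forms on F such that every nonzero k-linear combination αω + βω' has rank exactly 2. Then there exists a basis (f₁,…,f₅) of F, with dual basis (f₁*,…,f₅*) of F*, such that ω = f₁*∧f₂* and ω' = f₁*∧f₃*. -/
open Module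

section RankTwo

variable {k F : Type*} [Field k] [AddCommGroup F] [Module k F]

@[simp]
theorem wedge_apply_apply (φ ψ : F →ₗ[k] k) (x y : F) :
    wedge φ ψ x y = φ x * ψ y - ψ x * φ y := rfl

/-- The range of an alternating form on a finite-dimensional space is the annihilator of its
kernel. -/
theorem range_eq_dualAnnihilator_ker [FiniteDimensional k F] {ω : F →ₗ[k] F →ₗ[k] k}
    (halt : ω.IsAlt) :
    LinearMap.range ω = (LinearMap.ker ω).dualAnnihilator := by
  refine Submodule.eq_of_le_of_finrank_eq ?_ ?_
  · rintro _ ⟨x, rfl⟩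
    rw [Submodule.mem_dualAnnihilator]
    intro y hy
    rw [← halt.neg, LinearMap.mem_ker.mp hy, LinearMap.zero_apply, neg_zero]
  · exact Nat.add_right_cancel <| (LinearMap.finrank_range_add_finrank_ker ω).trans <|
      (Subspace.finrank_add_finrank_dualAnnihilator_eq (LinearMap.ker ω)).symm.trans
        (Nat.add_comm _ _)

/-- An alternating form of rank two is the wedge product of any nonzero functional in its range
with another functional. -/
theorem exists_eq_wedge_of_finrank_range_eq_two {ω : F →ₗ[k] F →ₗ[k] k} (halt : ω.IsAlt)
    (hrank : finrank k (LinearMap.range ω) = 2) {φ : F →ₗ[k] k}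
    (hφ : φ ∈ LinearMap.range ω) (hφ0 : φ ≠ 0) :
    ∃ ψ : F →ₗ[k] k, ω = wedge φ ψ := by
  obtain ⟨u, rfl⟩ := hφ
  obtain ⟨w, hw⟩ : ∃ w, ω u w ≠ 0 := by
    by_contra! h
    exact hφ0 (LinearMap.ext h)
  obtain ⟨v, huv⟩ : ∃ v, ω u v = 1 := ⟨(ω u w)⁻¹ • w, by simp [hw]⟩
  have hvu : ω v u = -1 := by rw [← halt.neg, huv]
  have hli : LinearIndependent k ![ω u, ω v] := by
    refine LinearIndependent.pair_iff.mpr fun s t h => ?_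
    have hu := LinearMap.congr_fun h u
    have hv := LinearMap.congr_fun h v
    simp only [LinearMap.add_apply, LinearMap.smul_apply, smul_eq_mul, halt.self_eq_zero, huv,
      hvu, LinearMap.zero_apply] at hu hv
    exact ⟨by linear_combination hv, by linear_combination -hu⟩
  have hspan : Submodule.span k (Set.range ![ω u, ω v]) = LinearMap.range ω := by
    have : FiniteDimensional k (LinearMap.range ω) := .of_finrank_pos (by omega)
    refine Submodule.eq_of_le_of_finrank_eq (Submodule.span_le.mpr ?_) ?_
    · rintro _ ⟨i, rfl⟩
      fin_cases i <;> exact LinearMap.mem_range_self ω _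
    · rw [finrank_span_eq_card hli, hrank, Fintype.card_fin]
  refine ⟨ω v, LinearMap.ext₂ fun z w => ?_⟩
  have hz : ω z ∈ Submodule.span k (Set.range ![ω u, ω v]) :=
    hspan ▸ LinearMap.mem_range_self ω z
  rw [Matrix.range_cons, Matrix.range_cons, Matrix.range_empty, Set.union_empty,
    Set.singleton_union, Submodule.mem_span_pair] at hz
  obtain ⟨a, b, hab⟩ := hz
  have hu := LinearMap.congr_fun hab u
  have hv := LinearMap.congr_fun hab v
  have hw := LinearMap.congr_fun hab w
  simp only [LinearMap.add_apply, LinearMap.smul_apply, smul_eq_mul, halt.self_eq_zero, huv,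
    hvu] at hu hv hw
  rw [wedge_apply_apply, ← hw]
  linear_combination ω u w * hv - ω v w * hu - ω u w * halt.neg z v + ω v w * halt.neg z u

/-- If two alternating forms and their sum have the same rank, and that rank is nonzero, then
the ranges of the two forms meet nontrivially. -/
theorem exists_mem_range_inf_range_ne_zero [FiniteDimensional k F]
    {ω ω' : F →ₗ[k] F →ₗ[k] k} (halt : ω.IsAlt) (halt' : ω'.IsAlt) (h0 : ω ≠ 0)
    (h : finrank k (LinearMap.range (ω + ω')) = finrank k (LinearMap.range ω))
    (h' : finrank k (LinearMap.range (ω + ω')) = finrank k (LinearMap.range ω')) :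
    ∃ φ ∈ LinearMap.range ω ⊓ LinearMap.range ω', φ ≠ 0 := by
  by_contra! hbot
  have hker : ∀ z ∈ LinearMap.ker (ω + ω'), ω z = 0 ∧ ω' z = 0 := by
    intro z hz
    have hz' : ω z + ω' z = 0 := hz
    have hωz : ω z = 0 := hbot _
      ⟨⟨z, rfl⟩, ⟨-z, by rw [map_neg, eq_comm, eq_neg_iff_add_eq_zero, hz']⟩⟩
    exact ⟨hωz, by simpa [hωz] using hz'⟩
  have d := LinearMap.finrank_range_add_finrank_ker (ω + ω')
  have d₁ := LinearMap.finrank_range_add_finrank_ker ω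
  have d₂ := LinearMap.finrank_range_add_finrank_ker ω'
  have e₁ : LinearMap.ker (ω + ω') = LinearMap.ker ω :=
    Submodule.eq_of_le_of_finrank_eq (fun z hz => (hker z hz).1) (by omega)
  have e₂ : LinearMap.ker (ω + ω') = LinearMap.ker ω' :=
    Submodule.eq_of_le_of_finrank_eq (fun z hz => (hker z hz).2) (by omega)
  have hrange : LinearMap.range ω = LinearMap.range ω' := by
    rw [range_eq_dualAnnihilator_ker halt, range_eq_dualAnnihilator_ker halt', ← e₁, ← e₂]
  refine h0 (LinearMap.ext fun z => hbot _ ⟨⟨z, rfl⟩, ?_⟩)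
  rw [← hrange]
  exact ⟨z, rfl⟩

/-- A linearly independent family of functionals extends to the coordinates of a basis. -/
theorem exists_basis_coord_eq [FiniteDimensional k F] {m n : ℕ} (hn : finrank k F = m + n)
    {φ : Fin m → Dual k F} (hφ : LinearIndependent k φ) :
    ∃ f : Basis (Fin (m + n)) k F, ∀ i, f.coord (Fin.castAdd n i) = φ i := by
  let B := Basis.sumExtend hφ
  have : Fintype (Fin m ⊕ Basis.sumExtendIndex hφ) := FiniteDimensional.fintypeBasisIndex B
  have : Fintype (Basis.sumExtendIndex hφ) := Fintype.ofInjective _ (Sum.inr_injective (α := Fin m))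
  have hcard : Fintype.card (Basis.sumExtendIndex hφ) = n := by
    have := Nat.card_congr (B.indexEquiv (finBasis k (Dual k F)))
    rw [Nat.card_sum, Nat.card_eq_fintype_card, Nat.card_eq_fintype_card,
      Nat.card_eq_fintype_card, Fintype.card_fin, Fintype.card_fin, Subspace.dual_finrank_eq,
      hn] at this
    exact Nat.add_left_cancel this
  let e : Fin m ⊕ Basis.sumExtendIndex hφ ≃ Fin (m + n) :=
    (Equiv.sumCongr (Equiv.refl _) (Fintype.equivFinOfCardEq hcard)).trans finSumFinEquiv
  let b := B.reindex e
  refine ⟨b.dualBasis.map (evalEquiv k F).symm, fun i => ?_⟩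
  have hb : b (Fin.castAdd n i) = φ i := by
    have : e.symm (Fin.castAdd n i) = Sum.inl i := by simp [e]
    rw [Basis.reindex_apply, this]
    simp only [B, Basis.sumExtend, Basis.reindex_apply, Basis.extend_apply_self]
    rfl
  rw [← hb]
  refine (b.dualBasis.map (evalEquiv k F).symm).ext fun j => ?_
  rw [Basis.coord_apply, Basis.repr_self, Basis.map_apply, apply_evalEquiv_symm_apply,
    Basis.dualBasis_apply_self, Finsupp.single_apply]
  simp [eq_comm]

/-- If `φ∧ψ` and `φ∧χ` are linearly independent, then so are `φ`, `ψ`, `χ`. -/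
theorem linearIndependent_of_wedge {φ ψ χ : F →ₗ[k] k}
    (h : LinearIndependent k ![wedge φ ψ, wedge φ χ]) : LinearIndependent k ![φ, ψ, χ] := by
  have hφ : φ ≠ 0 := by
    rintro rfl
    refine h.ne_zero 0 (LinearMap.ext₂ fun x y => ?_)
    simp
  rw [Fintype.linearIndependent_iff]
  intro g hg
  simp only [Fin.sum_univ_three, Matrix.cons_val] at hg
  obtain ⟨h₁, h₂⟩ := h.eq_zero_of_pair (s := g 1) (t := g 2) <| LinearMap.ext₂ fun x y => by
    have hx := LinearMap.congr_fun hg x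
    have hy := LinearMap.congr_fun hg y
    simp only [LinearMap.add_apply, LinearMap.smul_apply, smul_eq_mul, LinearMap.zero_apply,
      wedge_apply_apply] at hx hy ⊢
    linear_combination φ x * hy - φ y * hx
  have h₀ : g 0 = 0 := by simpa [h₁, h₂, hφ] using hg
  intro i
  fin_cases i <;> assumption

end RankTwo

/-- Let k be a field and F a 5-dimensional k-vector space. Let ω, ω' be linearly
independent alternating bilinear forms on F such that every nonzero k-linear combination
αω + βω' has rank exactly 2. Then there exists a basis (f₁,…,f₅) of F, with dual basis
(f₁*,…,f₅*), such that ω = f₁*∧f₂* and ω' = f₁*∧f₃*. -/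
theorem rank_two_pencil_normal_form
    (k : Type*) [Field k]
    (F : Type*) [AddCommGroup F] [Module k F] [FiniteDimensional k F]
    (hdim : finrank k F = 5)
    (ω ω' : F →ₗ[k] F →ₗ[k] k)
    (halt : ∀ x, ω x x = 0) (halt' : ∀ x, ω' x x = 0)
    (hindep : LinearIndependent k ![ω, ω'])
    (hrank : ∀ α β : k, (α, β) ≠ (0, 0) →
      finrank k (LinearMap.range (α • ω + β • ω')) = 2) :
    ∃ f : Basis (Fin 5) k F,
      ω = wedge (f.coord 0) (f.coord 1) ∧ ω' = wedge (f.coord 0) (f.coord 2) := by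
  have h : finrank k (LinearMap.range ω) = 2 := by
    rw [← hrank 1 0 (by simp), one_smul, zero_smul, add_zero]
  have h' : finrank k (LinearMap.range ω') = 2 := by
    rw [← hrank 0 1 (by simp), one_smul, zero_smul, zero_add]
  have hs : finrank k (LinearMap.range (ω + ω')) = 2 := by
    rw [← hrank 1 1 (by simp), one_smul, one_smul]
  obtain ⟨φ, ⟨hφ, hφ'⟩, hφ0⟩ := exists_mem_range_inf_range_ne_zero halt halt'
    (hindep.ne_zero 0) (hs.trans h.symm) (hs.trans h'.symm)
  obtain ⟨ψ, rfl⟩ := exists_eq_wedge_of_finrank_range_eq_two halt h hφ hφ0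
  obtain ⟨χ, rfl⟩ := exists_eq_wedge_of_finrank_range_eq_two halt' h' hφ' hφ0
  obtain ⟨f, hf⟩ := exists_basis_coord_eq (m := 3) (n := 2) hdim
    (linearIndependent_of_wedge hindep)
  have h₀ : f.coord 0 = φ := hf 0
  have h₁ : f.coord 1 = ψ := hf 1
  have h₂ : f.coord 2 = χ := hf 2
  exact ⟨f, by rw [h₀, h₁], by rw [h₀, h₂]⟩
end
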